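/- arXiv:0712.2857 — 3 statements merged into one kernel-verified Lean document; each statement's English description precedes it below -/
import Mathlib

section
/- For all integers n, t and l with 0 < t < n and 1 ≤ l ≤ n, the single-exclusion number satisfies S(n,t) ≤ (1/l)·binom(n,t) + binom(n−⌊n/l⌋, t) + binom(n−⌊n/l⌋, t−⌊n/l⌋) + g(n,t,l), where g(n,t,l) = Σ binom(l,i)·i·(i−1), the sum being over all integers i with (t+1)/⌈n/l⌉ ≤ i ≤ ⌈(t+1)/⌊n/l⌋⌉, and where binom(a,b) denotes the binomial coefficient (equal to 0 when b < 0 or b > a). -/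
/-- An `(n,t)`-single-exclusion system: a collection of `t`-subsets (blocks) of an
`n`-set such that every subset `X` with `1 ≤ |X| ≤ t+1` has a block containing all
but exactly one element of `X`. -/
def IsSESystem (n t : ℕ) (S : Finset (Finset (Fin n))) : Prop :=
  (∀ B ∈ S, B.card = t) ∧
  ∀ X : Finset (Fin n), 1 ≤ X.card → X.card ≤ t + 1 → ∃ B ∈ S, (X \ B).card = 1

/-- The `(n,t)`-single-exclusion number `S(n,t)`: the least number of blocks in an
`(n,t)`-single-exclusion system. -/
noncomputable def SENumber (n t : ℕ) : ℕ :=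
  sInf {m : ℕ | ∃ S : Finset (Finset (Fin n)), IsSESystem n t S ∧ S.card = m}
/-- Binomial coefficient with integer arguments, equal to `0` when either argument is
negative (in particular when the lower argument is negative), and to `Nat.choose`
otherwise (hence `0` when the lower argument exceeds the upper one). -/
def binom (a b : ℤ) : ℕ := if 0 ≤ a ∧ 0 ≤ b then a.toNat.choose b.toNat else 0

section Helpers

/-- Union of the parts indexed by `H`. -/
def seU {n l : ℕ} (f : Fin n → ZMod l) (H : Finset (ZMod l)) : Finset (Fin n) :=
  Finset.univ.filter (fun x => f x ∈ H)

/-- Parts that are missed by or contained in `B`. -/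
noncomputable def seD {n l : ℕ} [NeZero l] (f : Fin n → ZMod l) (B : Finset (Fin n)) :
    Finset (ZMod l) :=
  Finset.univ.filter (fun p => (∀ x, f x = p → x ∉ B) ∨ (∀ x, f x = p → x ∈ B))

open Classical in
/-- The main family. -/
noncomputable def seSys {n l : ℕ} [NeZero l] (f : Fin n → ZMod l) (t : ℕ) (j : ZMod l) :
    Finset (Finset (Fin n)) :=
  (Finset.powersetCard t Finset.univ).filter
    (fun B => j ∈ (Finset.range ((seD f B).card + 1)).image (fun s : ℕ => ∑ b ∈ B, f b + (s : ZMod l)))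

lemma se_pigeon {l : ℕ} [NeZero l] (Q : Finset (ZMod l)) (hQ : Q.Nonempty) (D : ℕ)
    (hD : D + Q.card = l) (c j : ZMod l) : ∃ q ∈ Q, ∃ s ≤ D, c - q + (s : ℕ) = j := by
  classical
  by_contra! hcon
  have hpos := hQ.card_pos
  have hdis : Disjoint ((Finset.range (D + 1)).image (fun s : ℕ => c + (s : ZMod l) - j)) Q := by
    rw [Finset.disjoint_left]
    intro q hq hqQ
    simp only [Finset.mem_image, Finset.mem_range] at hq
    obtain ⟨s, hs, rfl⟩ := hq
    exact hcon _ hqQ s (by omega) (by ring)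
  have hinj : ((Finset.range (D + 1)).image (fun s : ℕ => c + (s : ZMod l) - j)).card = D + 1 := by
    rw [Finset.card_image_of_injOn, Finset.card_range]
    intro a ha b hb hab
    simp only [Finset.coe_range, Set.mem_Iio] at ha hb
    have h1 : (a : ZMod l) = b := by simpa using hab
    rw [ZMod.natCast_eq_natCast_iff'] at h1
    rwa [Nat.mod_eq_of_lt (by omega), Nat.mod_eq_of_lt (by omega)] at h1
  have h2 := Finset.card_le_univ ((Finset.range (D + 1)).image (fun s : ℕ => c + (s : ZMod l) - j) ∪ Q)
  rw [Finset.card_union_of_disjoint hdis, hinj, ZMod.card] at h2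
  omega

lemma se_greedy {ι : Type*} [Fintype ι] [DecidableEq ι] (g : Finset ι → ℕ) (P : Finset ι) (r : ℕ)
    (h0 : g P ≤ r) (h1 : r < g Finset.univ) :
    ∃ H, P ⊆ H ∧ ∃ q ∉ H, g H ≤ r ∧ r < g (insert q H) := by
  by_contra! hcon
  have key : ∀ G : Finset ι, g (P ∪ G) ≤ r := by
    intro G
    induction G using Finset.induction_on with
    | empty => simpa using h0
    | insert a G ha ih =>
      by_cases haP : a ∈ P ∪ G
      · have : P ∪ insert a G = P ∪ G := by
          rw [Finset.union_insert, Finset.insert_eq_of_mem haP]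
        rwa [this]
      · rw [Finset.union_insert]
        exact hcon _ Finset.subset_union_left a haP ih
  have := key Finset.univ
  rw [Finset.union_eq_right.2 (Finset.subset_univ P)] at this
  omega

lemma se_block {n l : ℕ} [NeZero l] (f : Fin n → ZMod l) (t : ℕ) (X : Finset (Fin n))
    (c : ZMod l) (Q : Finset (ZMod l)) (hQ : Q.Nonempty)
    (h : ∀ q ∈ Q, ∃ B : Finset (Fin n), B.card = t ∧ (X \ B).card = 1 ∧ ∑ b ∈ B, f b = c - q ∧
      ∀ p ∉ Q, p ∈ seD f B) (j : ZMod l) : ∃ B ∈ seSys f t j, (X \ B).card = 1 := by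
  classical
  have hle : Q.card ≤ l := by simpa [ZMod.card] using Finset.card_le_univ Q
  obtain ⟨q, hq, s, hs, hj⟩ := se_pigeon Q hQ (l - Q.card) (by omega) c j
  obtain ⟨B, hB, hX, hw, hd⟩ := h q hq
  refine ⟨B, ?_, hX⟩
  have hc : l - Q.card ≤ (seD f B).card := by
    have : Qᶜ ⊆ seD f B := fun p hp => hd p (by simpa using hp)
    have h2 := Finset.card_le_card this
    rwa [Finset.card_compl, ZMod.card] at h2
  simp only [seSys, Finset.mem_filter, Finset.mem_powersetCard, Finset.mem_image, Finset.mem_range]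
  exact ⟨⟨Finset.subset_univ _, hB⟩, s, by omega, by rw [hw]; exact hj⟩

lemma se_sdiff_one {n : ℕ} (X B : Finset (Fin n)) (x : Fin n)
    (h : ∀ y, (y ∈ X ∧ y ∉ B) ↔ y = x) : (X \ B).card = 1 := by
  rw [Finset.card_eq_one]
  exact ⟨x, by ext y; simpa using h y⟩

/-- Non-exceptional sets. -/
lemma se_main {n l : ℕ} [NeZero l] (f : Fin n → ZMod l) (t : ℕ) (htn : t < n) (X : Finset (Fin n))
    (hX1 : X.Nonempty) (hX2 : X.card ≤ t + 1)
    (hX3 : X.card ≤ t → ∃ z ∉ X, ∃ x ∈ X, f x = f z) (j : ZMod l) :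
    ∃ B ∈ seSys f t j, (X \ B).card = 1 := by
  classical
  set P := X.image f with hP
  have hPn : P.Nonempty := hX1.image f
  -- simple situation
  have simple : ∀ W : Finset (Fin n), X ⊆ W → W.card = t + 1 →
      (∀ p ∉ P, p ∈ seD f W) → ∃ B ∈ seSys f t j, (X \ B).card = 1 := by
    intro W hXW hW hd
    refine se_block f t X (∑ b ∈ W, f b) P hPn ?_ j
    intro q hq
    obtain ⟨x, hx, rfl⟩ := Finset.mem_image.1 hq
    refine ⟨W.erase x, by rw [Finset.card_erase_of_mem (hXW hx), hW]; rfl, ?_, ?_, ?_⟩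
    · apply se_sdiff_one X _ x
      intro y
      constructor
      · rintro ⟨h1, h2⟩
        by_contra h3
        exact h2 (Finset.mem_erase.2 ⟨h3, hXW h1⟩)
      · rintro rfl
        exact ⟨hx, by simp⟩
    · rw [← Finset.add_sum_erase W f (hXW hx)]; ring
    · intro p hp
      have := hd p hp
      simp only [seD, Finset.mem_filter, Finset.mem_univ, true_and] at this ⊢
      have hne : ∀ y, f y = p → y ≠ x := by
        rintro y rfl rfl
        exact hp hq
      rcases this with h | h
      · left; intro y hy hyW; exact h y hy (Finset.mem_of_mem_erase hyW)
      · right; intro y hy; exact Finset.mem_erase.2 ⟨hne y hy, h y hy⟩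
  by_cases hbig : (X ∪ seU f (Finset.univ \ P)).card ≤ t + 1
  · obtain ⟨W, hW1, -, hW2⟩ := Finset.exists_subsuperset_card_eq (Finset.subset_univ _) hbig
      (by simpa using htn)
    refine simple W (Finset.subset_union_left.trans hW1) hW2 ?_
    intro p hp
    simp only [seD, Finset.mem_filter, Finset.mem_univ, true_and]
    right
    rintro y rfl
    apply hW1
    simp [seU, hp]
  push Not at hbig
  obtain ⟨H, hPH, q, hqH, hH1, hH2⟩ := se_greedy (fun H => (X ∪ seU f (H \ P)).card) P (t + 1)
    (by simpa [seU] using hX2) hbig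
  obtain ⟨W, hW1, hW3, hW2⟩ := Finset.exists_subsuperset_card_eq
    (s := X ∪ seU f (H \ P)) (t := X ∪ seU f (insert q H \ P)) (n := t + 1) (by
      apply Finset.union_subset_union_right
      intro y
      simp only [seU, Finset.mem_filter, Finset.mem_univ, true_and, Finset.mem_sdiff,
        Finset.mem_insert]
      tauto) hH1 hH2.le
  have hXW : X ⊆ W := Finset.subset_union_left.trans hW1
  have hqP : q ∉ P := fun h => hqH (hPH h)
  have hXP : ∀ y ∈ X, f y ∈ P := fun y hy => Finset.mem_image_of_mem f hy
  have hWmem : ∀ y ∈ W, y ∈ X ∨ ((f y = q ∨ f y ∈ H) ∧ f y ∉ P) := by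
    intro y hy
    simpa [seU] using hW3 hy
  have hfull : ∀ y, f y ∈ H → f y ∉ P → y ∈ W := by
    intro y h1 h2
    apply hW1
    simp [seU, h1, h2]
  have hd : ∀ p ∉ P, p ≠ q → p ∈ seD f W := by
    intro p hp hpq
    simp only [seD, Finset.mem_filter, Finset.mem_univ, true_and]
    by_cases hpH : p ∈ H
    · right
      rintro y rfl
      exact hfull y hpH hp
    · left
      rintro y rfl hy
      rcases hWmem y hy with h | ⟨h | h, -⟩
      · exact hp (hXP y h)
      · exact hpq h
      · exact hpH h
  by_cases hz : ∃ z ∈ W, f z = q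
  swap
  · push Not at hz
    refine simple W hXW hW2 ?_
    intro p hp
    by_cases hpq : p = q
    · simp only [seD, Finset.mem_filter, Finset.mem_univ, true_and]
      left
      rintro y rfl hy
      exact hz y hy hpq
    · exact hd p hp hpq
  obtain ⟨z, hzW, hzq⟩ := hz
  have hzX : z ∉ X := fun h => hqP (hzq ▸ hXP z h)
  have hXt : X.card ≤ t := by
    have : X ⊂ W := Finset.ssubset_iff_subset_ne.2 ⟨hXW, by rintro rfl; exact hzX hzW⟩
    have := Finset.card_lt_card this
    omega
  obtain ⟨z', hz'X, x', hx', hfx⟩ := hX3 hXt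
  have hz'P : f z' ∈ P := hfx ▸ hXP x' hx'
  have hz'W : z' ∉ W := by
    intro h
    rcases hWmem z' h with h | ⟨-, h⟩
    · exact hz'X h
    · exact h hz'P
  refine se_block f t X (∑ b ∈ W, f b) (insert q P) (Finset.insert_nonempty _ _) ?_ j
  intro p hp
  rcases Finset.mem_insert.1 hp with rfl | hp
  · -- swap
    have hx'z : x' ≠ z := by rintro rfl; exact hzX hx'
    have hm1 : x' ∈ W.erase z := Finset.mem_erase.2 ⟨hx'z, hXW hx'⟩
    have hnot : z' ∉ (W.erase z).erase x' := by simp [hz'W]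
    refine ⟨insert z' ((W.erase z).erase x'), ?_, ?_, ?_, ?_⟩
    · rw [Finset.card_insert_of_notMem hnot]
      have h1 := Finset.card_erase_add_one hm1
      have h2 := Finset.card_erase_add_one hzW
      omega
    · apply se_sdiff_one X _ x'
      intro y
      simp only [Finset.mem_insert, Finset.mem_erase]
      constructor
      · rintro ⟨h1, h2⟩
        by_contra h3
        exact h2 (Or.inr ⟨h3, by rintro rfl; exact hzX h1, hXW h1⟩)
      · rintro rfl
        refine ⟨hx', ?_⟩
        rintro (h | h)
        · exact hz'X (h ▸ hx')
        · exact h.1 rfl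
    · rw [Finset.sum_insert hnot, ← Finset.add_sum_erase W f hzW,
        ← Finset.add_sum_erase (W.erase z) f hm1, hfx, hzq]
      ring
    · intro p hp
      simp only [Finset.mem_insert, not_or] at hp
      have := hd p hp.2 hp.1
      simp only [seD, Finset.mem_filter, Finset.mem_univ, true_and] at this ⊢
      simp only [Finset.mem_insert, Finset.mem_erase]
      have hpP := hXP x' hx'
      have n1 : ∀ y, f y = p → y ≠ z' := by rintro y rfl rfl; exact hp.2 hz'P
      have n2 : ∀ y, f y = p → y ≠ x' := by rintro y rfl rfl; exact hp.2 hpP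
      have n3 : ∀ y, f y = p → y ≠ z := by rintro y rfl rfl; exact hp.1 hzq
      rcases this with h | h
      · left
        rintro y hy (h1 | h1)
        · exact n1 y hy h1
        · exact h y hy h1.2.2
      · right
        intro y hy
        exact Or.inr ⟨n2 y hy, n3 y hy, h y hy⟩
  · obtain ⟨x, hx, rfl⟩ := Finset.mem_image.1 hp
    refine ⟨W.erase x, by rw [Finset.card_erase_of_mem (hXW hx), hW2]; rfl, ?_, ?_, ?_⟩
    · apply se_sdiff_one X _ x
      intro y
      constructor
      · rintro ⟨h1, h2⟩
        by_contra h3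
        exact h2 (Finset.mem_erase.2 ⟨h3, hXW h1⟩)
      · rintro rfl
        exact ⟨hx, by simp⟩
    · rw [← Finset.add_sum_erase W f (hXW hx)]; ring
    · intro p hp'
      simp only [Finset.mem_insert, not_or] at hp'
      have := hd p hp'.2 hp'.1
      simp only [seD, Finset.mem_filter, Finset.mem_univ, true_and] at this ⊢
      have hne : ∀ y, f y = p → y ≠ x := by
        rintro y rfl rfl
        exact hp'.2 hp
      rcases this with h | h
      · left; intro y hy hyW; exact h y hy (Finset.mem_of_mem_erase hyW)
      · right; intro y hy; exact Finset.mem_erase.2 ⟨hne y hy, h y hy⟩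

/-- Blocks for exceptional sets. -/
def seGood {n l : ℕ} (f : Fin n → ZMod l) (t : ℕ) (I : Finset (ZMod l)) (pq : ZMod l × ZMod l)
    (B : Finset (Fin n)) : Prop :=
  B.card = t ∧ ∃ x, f x = pq.1 ∧ ∀ y, f y ∈ I → f y ≠ pq.2 → (y ∉ B ↔ y = x)

lemma se_extra {n l : ℕ} [NeZero l] (f : Fin n → ZMod l) (t lo hi : ℕ) :
    ∃ E : Finset (Finset (Fin n)), (∀ B ∈ E, B.card = t) ∧
      (E.card ≤ ∑ i ∈ Finset.Icc lo hi, l.choose i * (i * (i - 1))) ∧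
      ∀ I : Finset (ZMod l), lo ≤ I.card → I.card ≤ hi → ∀ p ∈ I, ∀ q ∈ I, p ≠ q →
        (∃ B, seGood f t I (p, q) B) → ∃ B ∈ E, seGood f t I (p, q) B := by
  classical
  let blk : Finset (ZMod l) → ZMod l × ZMod l → Finset (Fin n) := fun I pq =>
    if h : ∃ B, seGood f t I pq B then h.choose else ∅
  let E0 := (Finset.Icc lo hi).biUnion (fun i =>
    (Finset.powersetCard i (Finset.univ : Finset (ZMod l))).biUnion (fun I => I.offDiag.image (blk I)))
  refine ⟨E0.filter (fun B => B.card = t), fun B hB => (Finset.mem_filter.1 hB).2, ?_, ?_⟩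
  · refine (Finset.card_filter_le _ _).trans (Finset.card_biUnion_le.trans ?_)
    apply Finset.sum_le_sum
    intro i _
    refine (Finset.card_biUnion_le_card_mul _ _ (i * (i - 1)) ?_).trans ?_
    · intro I hI
      refine Finset.card_image_le.trans ?_
      rw [Finset.offDiag_card, (Finset.mem_powersetCard.1 hI).2, Nat.mul_sub, mul_one]
    · rw [Finset.card_powersetCard, Finset.card_univ, ZMod.card]
  · intro I h1 h2 p hp q hq hpq hB
    have hg : seGood f t I (p, q) (blk I (p, q)) := by
      simp only [blk, dif_pos hB]
      exact hB.choose_spec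
    refine ⟨blk I (p, q), ?_, hg⟩
    simp only [E0, Finset.mem_filter, Finset.mem_biUnion, Finset.mem_image, Finset.mem_Icc,
      Finset.mem_powersetCard, Finset.mem_offDiag]
    exact ⟨⟨I.card, ⟨h1, h2⟩, I, ⟨Finset.subset_univ _, rfl⟩, (p, q), ⟨hp, hq, hpq⟩, rfl⟩, hg.1⟩

lemma se_cardU {n l : ℕ} [NeZero l] (f : Fin n → ZMod l) (k c : ℕ)
    (hk : ∀ p, k ≤ (Finset.univ.filter (fun x => f x = p)).card)
    (hc : ∀ p, (Finset.univ.filter (fun x => f x = p)).card ≤ c) (H : Finset (ZMod l)) :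
    H.card * k ≤ (seU f H).card ∧ (seU f H).card ≤ H.card * c := by
  classical
  have h : (seU f H).card = ∑ p ∈ H, (Finset.univ.filter (fun x => f x = p)).card := by
    rw [Finset.card_eq_sum_card_fiberwise (f := f) (t := H)]
    · apply Finset.sum_congr rfl
      intro p hp
      congr 1
      ext y
      simp only [seU, Finset.mem_filter, Finset.mem_univ, true_and]
      constructor
      · exact fun h => h.2
      · rintro rfl; exact ⟨hp, rfl⟩
    · intro y hy
      simpa [seU] using hy
  rw [h]
  constructor
  · simpa using Finset.card_nsmul_le_sum H _ k (fun p _ => hk p)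
  · simpa using Finset.sum_le_card_nsmul H _ c (fun p _ => hc p)

/-- Exceptional sets. -/
lemma se_exc {n l : ℕ} [NeZero l] (f : Fin n → ZMod l) (t : ℕ) (htn : t < n) (k c : ℕ)
    (hk0 : 0 < k) (hk : ∀ p, k ≤ (Finset.univ.filter (fun x => f x = p)).card)
    (hc : ∀ p, (Finset.univ.filter (fun x => f x = p)).card ≤ c)
    (E : Finset (Finset (Fin n)))
    (hE : ∀ I : Finset (ZMod l), (t + 1 + c - 1) / c ≤ I.card → I.card ≤ (t + 1 + k - 1) / k →
      ∀ p ∈ I, ∀ q ∈ I, p ≠ q →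
        (∃ B, seGood f t I (p, q) B) → ∃ B ∈ E, seGood f t I (p, q) B)
    (X : Finset (Fin n)) (hX1 : X.Nonempty) (hX2 : X.card ≤ t)
    (hX3 : ∀ z, ∀ x ∈ X, f x = f z → z ∈ X) : ∃ B ∈ E, (X \ B).card = 1 := by
  classical
  have hXU : seU f (X.image f) = X := by
    ext y
    simp only [seU, Finset.mem_filter, Finset.mem_univ, true_and, Finset.mem_image]
    constructor
    · rintro ⟨x, hx, h⟩; exact hX3 y x hx h
    · intro h; exact ⟨y, h, rfl⟩
  obtain ⟨H, hPH, q, hqH, h1, h2⟩ := se_greedy (fun H => (seU f H).card) (X.image f) t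
    (by simpa [hXU] using hX2) (by simpa [seU] using htn)
  obtain ⟨x, hx⟩ := hX1
  have hxH : f x ∈ H := hPH (Finset.mem_image_of_mem f hx)
  have hxq : f x ≠ q := by rintro h; exact hqH (h ▸ hxH)
  have b1 := (se_cardU f k c hk hc H).1
  have b2 := (se_cardU f k c hk hc (insert q H)).2
  have hcI := Finset.card_insert_of_notMem hqH
  have hc0 : 0 < c := hk0.trans_le ((hk 0).trans (hc 0))
  obtain ⟨B, hB, -, x0, hx0, hy⟩ := hE (insert q H)
    (by
      have : t + 1 + c - 1 = t + c := by omega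
      rw [this]
      apply Nat.le_of_lt_succ
      rw [Nat.div_lt_iff_lt_mul hc0, Nat.succ_mul]
      omega)
    (by
      rw [hcI, Nat.le_div_iff_mul_le hk0, Nat.succ_mul]
      omega) (f x) (Finset.mem_insert_of_mem hxH) q (Finset.mem_insert_self _ _) hxq
    (by
      have hxU : x ∈ seU f H := by simp [seU, hxH]
      have hsub : seU f H ⊆ seU f (insert q H) := by
        intro y
        simp only [seU, Finset.mem_filter, Finset.mem_univ, true_and, Finset.mem_insert]
        tauto
      have c1 := Finset.card_erase_add_one hxU
      have c2 := Finset.card_erase_add_one (hsub hxU)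
      obtain ⟨B, hB1, hB2, hB3⟩ := Finset.exists_subsuperset_card_eq (n := t)
        (Finset.erase_subset_erase x hsub) (by omega) (by omega)
      refine ⟨B, hB3, x, rfl, ?_⟩
      intro y hyI hyq
      have hyH : f y ∈ H := (Finset.mem_insert.1 hyI).resolve_left hyq
      constructor
      · intro h
        by_contra h3
        exact h (hB1 (Finset.mem_erase.2 ⟨h3, by simp [seU, hyH]⟩))
      · rintro rfl h
        exact (Finset.mem_erase.1 (hB2 h)).1 rfl)
  refine ⟨B, hB, se_sdiff_one X B x0 ?_⟩
  have key : ∀ y ∈ X, (y ∉ B ↔ y = x0) := by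
    intro y hyX
    have hyH : f y ∈ H := hPH (Finset.mem_image_of_mem f hyX)
    exact hy y (Finset.mem_insert_of_mem hyH) (by intro h; change f y = q at h; exact hqH (h ▸ hyH))
  have hx0X : x0 ∈ X := hX3 x0 x hx hx0.symm
  intro y
  constructor
  · rintro ⟨h3, h4⟩; exact (key y h3).1 h4
  · rintro rfl; exact ⟨hx0X, (key y hx0X).2 rfl⟩

lemma se_count_miss {n : ℕ} (A : Finset (Fin n)) (t : ℕ) :
    ((Finset.powersetCard t Finset.univ).filter (fun B => ∀ x ∈ A, x ∉ B)).card
      = (n - A.card).choose t := by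
  classical
  have : (Finset.powersetCard t Finset.univ).filter (fun B => ∀ x ∈ A, x ∉ B)
      = Finset.powersetCard t Aᶜ := by
    ext B
    simp only [Finset.mem_filter, Finset.mem_powersetCard, Finset.subset_univ, true_and]
    constructor
    · rintro ⟨h1, h2⟩
      exact ⟨fun y hy => Finset.mem_compl.2 fun h => h2 y h hy, h1⟩
    · rintro ⟨h1, h2⟩
      exact ⟨h2, fun x hx hB => Finset.mem_compl.1 (h1 hB) hx⟩
  rw [this, Finset.card_powersetCard, Finset.card_compl, Fintype.card_fin]

lemma se_count_full {n : ℕ} (A : Finset (Fin n)) (t : ℕ) (htn : t ≤ n) :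
    ((Finset.powersetCard t Finset.univ).filter (fun B => ∀ x ∈ A, x ∈ B)).card
      = (n - A.card).choose (n - t) := by
  classical
  rw [← se_count_miss A (n - t)]
  refine Finset.card_bij' (fun B _ => Bᶜ) (fun B _ => Bᶜ) ?_ ?_ ?_ ?_
  · intro B hB
    simp only [Finset.mem_filter, Finset.mem_powersetCard, Finset.subset_univ, true_and] at hB ⊢
    refine ⟨by rw [Finset.card_compl, Fintype.card_fin, hB.1], fun x hx => by simpa using hB.2 x hx⟩
  · intro B hB
    simp only [Finset.mem_filter, Finset.mem_powersetCard, Finset.subset_univ, true_and] at hB ⊢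
    refine ⟨by rw [Finset.card_compl, Fintype.card_fin, hB.1]; omega,
      fun x hx => by simpa using hB.2 x hx⟩
  · intro B _; simp
  · intro B _; simp

lemma se_sum_le {n l : ℕ} [NeZero l] (f : Fin n → ZMod l) (t : ℕ) (htn : t < n) (k : ℕ)
    (hk : ∀ p, k ≤ (Finset.univ.filter (fun x => f x = p)).card) :
    ∑ j, (seSys f t j).card ≤
      n.choose t + l * (n - k).choose t + l * (n - k).choose (n - t) := by
  classical
  have h1 : ∑ j, (seSys f t j).card ≤
      ∑ B ∈ Finset.powersetCard t (Finset.univ : Finset (Fin n)), ((seD f B).card + 1) := by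
    simp only [seSys, Finset.card_filter]
    rw [Finset.sum_comm]
    apply Finset.sum_le_sum
    intro B _
    rw [← Finset.card_filter, Finset.filter_univ_mem]
    exact Finset.card_image_le.trans (by simp)
  refine h1.trans ?_
  rw [Finset.sum_add_distrib]
  have h2 : ∑ B ∈ Finset.powersetCard t (Finset.univ : Finset (Fin n)), (seD f B).card ≤
      ∑ _p : ZMod l, ((n - k).choose t + (n - k).choose (n - t)) := by
    simp only [seD, Finset.card_filter]
    rw [Finset.sum_comm]
    apply Finset.sum_le_sum
    intro p _
    rw [← Finset.card_filter, Finset.filter_or]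
    refine (Finset.card_union_le _ _).trans ?_
    have e1 := se_count_miss (Finset.univ.filter (fun x => f x = p)) t
    have e2 := se_count_full (Finset.univ.filter (fun x => f x = p)) t htn.le
    simp only [Finset.mem_filter, Finset.mem_univ, true_and] at e1 e2
    rw [e1, e2]
    have := hk p
    exact add_le_add (Nat.choose_le_choose _ (by omega)) (Nat.choose_le_choose _ (by omega))
  simp only [Finset.sum_const, Finset.card_univ, ZMod.card, smul_eq_mul, Finset.card_powersetCard,
    Fintype.card_fin, mul_one] at h2 ⊢
  rw [mul_add] at h2
  omega

lemma se_parts (n l : ℕ) [NeZero l] (p : ZMod l) :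
    n / l ≤ (Finset.univ.filter (fun x : Fin n => ((x.val : ℕ) : ZMod l) = p)).card ∧
    (Finset.univ.filter (fun x : Fin n => ((x.val : ℕ) : ZMod l) = p)).card ≤ (n + l - 1) / l := by
  have hl : 0 < l := Nat.pos_of_ne_zero (NeZero.ne l)
  have h : (Finset.univ.filter (fun x : Fin n => ((x.val : ℕ) : ZMod l) = p)).card
      = n.count (· ≡ p.val [MOD l]) := by
    rw [Nat.count_eq_card_filter_range, ← Finset.card_map Fin.valEmbedding]
    congr 1
    ext y
    simp only [Finset.mem_map, Finset.mem_filter, Finset.mem_univ, true_and, Finset.mem_range,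
      Fin.valEmbedding_apply, ← ZMod.natCast_eq_natCast_iff, ZMod.natCast_val, ZMod.cast_id', id]
    constructor
    · rintro ⟨a, ha, rfl⟩; exact ⟨a.2, ha⟩
    · rintro ⟨h1, h2⟩; exact ⟨⟨y, h1⟩, h2, rfl⟩
  rw [h, Nat.count_modEq_card n hl]
  constructor
  · omega
  · split_ifs with h3
    · have : n % l ≥ 1 := by omega
      have h4 := Nat.div_add_mod n l
      rw [Nat.le_div_iff_mul_le hl, Nat.add_mul, mul_comm (n / l)]
      omega
    · exact Nat.div_le_div_right (by omega)

end Helpers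

theorem stmt5 (n t l : ℕ) (ht : 0 < t) (htn : t < n) (hl1 : 1 ≤ l) (hl2 : l ≤ n) :
    (SENumber n t : ℝ) ≤ (1 / (l : ℝ)) * (n.choose t : ℝ) +
      ((n - n / l).choose t : ℝ) +
      (binom ((n : ℤ) - (n / l : ℕ)) ((t : ℤ) - (n / l : ℕ)) : ℝ) +
      ∑ i ∈ Finset.Icc ((t + 1 + ((n + l - 1) / l) - 1) / ((n + l - 1) / l))
          ((t + 1 + (n / l) - 1) / (n / l)),
        (l.choose i : ℝ) * (i : ℝ) * ((i : ℝ) - 1) := by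
  classical
  have : NeZero l := ⟨by omega⟩
  have hk0 : 0 < n / l := Nat.div_pos hl2 hl1
  have hkn : n / l ≤ n := Nat.div_le_self n l
  have hparts := se_parts n l
  generalize hfdef : (fun x : Fin n => ((x.val : ℕ) : ZMod l)) = f
  have hk : ∀ p, n / l ≤ (Finset.univ.filter (fun x => f x = p)).card := by
    subst hfdef; exact fun p => (hparts p).1
  have hc : ∀ p, (Finset.univ.filter (fun x => f x = p)).card ≤ (n + l - 1) / l := by
    subst hfdef; exact fun p => (hparts p).2
  generalize n / l = k at *
  generalize (n + l - 1) / l = c at *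
  obtain ⟨E, hE1, hE2, hE3⟩ := se_extra f t ((t + 1 + c - 1) / c) ((t + 1 + k - 1) / k)
  have hsum := se_sum_le f t htn k hk
  obtain ⟨j, hj⟩ : ∃ j, l * (seSys f t j).card ≤
      n.choose t + l * (n - k).choose t + l * (n - k).choose (n - t) := by
    by_contra! hcon
    have h1 : ∑ j : ZMod l, (n.choose t + l * (n - k).choose t + l * (n - k).choose (n - t)) <
        ∑ j : ZMod l, l * (seSys f t j).card :=
      Finset.sum_lt_sum_of_nonempty Finset.univ_nonempty (fun j _ => hcon j)
    rw [← Finset.mul_sum, Finset.sum_const, Finset.card_univ, ZMod.card, smul_eq_mul] at h1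
    exact absurd (Nat.mul_le_mul_left l hsum) (not_le.2 h1)
  have hSE : SENumber n t ≤ (seSys f t j).card + E.card := by
    refine le_trans (Nat.sInf_le ⟨seSys f t j ∪ E, ⟨?_, ?_⟩, rfl⟩) (Finset.card_union_le _ _)
    · intro B hB
      rcases Finset.mem_union.1 hB with h | h
      · exact (Finset.mem_powersetCard.1 (Finset.mem_filter.1 h).1).2
      · exact hE1 B h
    · intro X hX1 hX2
      have hXn : X.Nonempty := Finset.card_pos.1 hX1
      by_cases hex : X.card ≤ t ∧ ∀ z, ∀ x ∈ X, f x = f z → z ∈ X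
      · obtain ⟨B, hB, h⟩ := se_exc f t htn k c hk0 hk hc E hE3 X hXn hex.1 hex.2
        exact ⟨B, Finset.mem_union_right _ hB, h⟩
      · obtain ⟨B, hB, h⟩ := se_main f t htn X hXn hX2 (by
          intro h
          by_contra! hcon
          refine hex ⟨h, ?_⟩
          intro z x hx hfx
          by_contra hz
          exact hcon z hz x hx hfx) j
        exact ⟨B, Finset.mem_union_left _ hB, h⟩
  have hbin : binom ((n : ℤ) - (k : ℕ)) ((t : ℤ) - (k : ℕ)) = (n - k).choose (n - t) := by
    unfold binom
    by_cases hkt : k ≤ t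
    · rw [if_pos (by omega)]
      have e1 : ((n : ℤ) - (k : ℕ)).toNat = n - k := by omega
      have e2 : ((t : ℤ) - (k : ℕ)).toNat = t - k := by omega
      rw [e1, e2, ← Nat.choose_symm (by omega : t - k ≤ n - k)]
      congr 1
      omega
    · rw [if_neg (by omega), Nat.choose_eq_zero_of_lt (by omega)]
  rw [hbin]
  have hg : ((∑ i ∈ Finset.Icc ((t + 1 + c - 1) / c) ((t + 1 + k - 1) / k),
      l.choose i * (i * (i - 1)) : ℕ) : ℝ) =
      ∑ i ∈ Finset.Icc ((t + 1 + c - 1) / c) ((t + 1 + k - 1) / k),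
        (l.choose i : ℝ) * (i : ℝ) * ((i : ℝ) - 1) := by
    push_cast
    apply Finset.sum_congr rfl
    intro i _
    rcases Nat.eq_zero_or_pos i with rfl | hi
    · simp
    · rw [Nat.cast_sub hi]; push_cast; ring
  rw [← hg]
  have hlR : (0 : ℝ) < l := by exact_mod_cast hl1
  have hj' : (l : ℝ) * (seSys f t j).card ≤
      n.choose t + l * (n - k).choose t + l * (n - k).choose (n - t) := by exact_mod_cast hj
  have hj2 : ((seSys f t j).card : ℝ) ≤
      1 / (l : ℝ) * n.choose t + (n - k).choose t + (n - k).choose (n - t) := by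
    rw [← mul_le_mul_iff_right₀ hlR]
    refine hj'.trans (le_of_eq ?_)
    field_simp
  have hSE' : (SENumber n t : ℝ) ≤ (seSys f t j).card + E.card := by exact_mod_cast hSE
  have hE2' : (E.card : ℝ) ≤ ((∑ i ∈ Finset.Icc ((t + 1 + c - 1) / c) ((t + 1 + k - 1) / k),
      l.choose i * (i * (i - 1)) : ℕ) : ℝ) := by exact_mod_cast hE2
  linarith
end

section
/- For all integers n and t with 0 < t < n − 1 and all positive integers l_0, l_1, …, l_t such that for each i ∈ {0,…,t} the quantity l_i − 1 − l_i(i−1)/(m+i) is positive, where m = n − t − 1, the single-exclusion number satisfies S(n,t) ≤ Σ_{i=0}^{t} f_{n,t}(i, l_i), where f_{n,t}(i, l) = [ 1/(2l) + (1/2)·( 3 + i/( l − 1 − l(i−1)/(m+i) ) )·(1 − 1/l)^i ]·binom(m+i, i). -/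
namespace SEProof
open Finset

section star
variable {V : Type*} [LinearOrder V]

/-- non-minimal elements -/
def nonmin (S : Finset V) : Finset V := S.filter (fun x => ∃ y ∈ S, y < x)

def star (S : Finset V) : Finset V := if Even S.card then S else nonmin S

lemma nonmin_card (S : Finset V) (h : S.Nonempty) : (nonmin S).card + 1 = S.card := by
  have : nonmin S = S.erase (S.min' h) := by
    ext x
    simp only [nonmin, mem_filter, mem_erase]
    constructor
    · rintro ⟨hx, y, hy, hyx⟩
      refine ⟨?_, hx⟩
      rintro rfl
      exact absurd (S.min'_le y hy) (not_le.2 hyx)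
    · rintro ⟨hne, hx⟩
      exact ⟨hx, S.min' h, S.min'_mem h, lt_of_le_of_ne (S.min'_le x hx) (Ne.symm hne)⟩
  rw [this, card_erase_add_one (S.min'_mem h)]

lemma star_empty (S : Finset V) (h : star S = ∅) : S.card ≤ 1 := by
  unfold star at h
  split_ifs at h with he
  · simp [h]
  · have hne : S.Nonempty := by
      rw [nonempty_iff_ne_empty]; rintro rfl; simp at he
    have := nonmin_card S hne
    rw [h] at this
    simp at this; omega

lemma star_erase (S : Finset V) (h : S.Nonempty) :
    ∃ S' ⊆ S, Odd S'.card ∧ ∀ x ∈ S', star (S.erase x) = S'.erase x := by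
  by_cases he : Even S.card
  · refine ⟨nonmin S, filter_subset _ _, ?_, ?_⟩
    · have := nonmin_card S h
      rw [← this] at he
      rw [← Nat.not_even_iff_odd]
      intro h2
      exact absurd he (by simp [Nat.even_add_one, h2])
    · intro x hx
      have hxS : x ∈ S := filter_subset _ _ hx
      have hc := card_erase_add_one hxS
      have : ¬ Even (S.erase x).card := by
        intro h2
        rw [← hc] at he
        exact absurd he (by simp [Nat.even_add_one, h2])
      rw [star, if_neg this]
      ext z
      simp only [nonmin, mem_filter, mem_erase] at hx ⊢
      obtain ⟨_, y0, hy0, hy0x⟩ := hx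
      constructor
      · rintro ⟨⟨hzx, hz⟩, y, ⟨_, hy⟩, hyz⟩
        exact ⟨hzx, hz, y, hy, hyz⟩
      · rintro ⟨hzx, hz, y, hy, hyz⟩
        refine ⟨⟨hzx, hz⟩, ?_⟩
        by_cases hyx : y = x
        · subst hyx
          exact ⟨y0, ⟨hy0x.ne, hy0⟩, hy0x.trans hyz⟩
        · exact ⟨y, ⟨hyx, hy⟩, hyz⟩
  · refine ⟨S, Subset.rfl, Nat.not_even_iff_odd.1 he, ?_⟩
    intro x hx
    have hc := card_erase_add_one hx
    have : Even (S.erase x).card := by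
      by_contra h2
      rw [← hc] at he
      exact absurd he (by simp [Nat.even_add_one, h2])
    rw [star, if_pos this]

end star

section turan
variable {V : Type*} [Fintype V] [LinearOrder V] {l : ℕ} [NeZero l]

def part (χ : V → ZMod l) (B : Finset V) (c : ZMod l) : Finset V := B.filter (fun x => χ x = c)

def gg (χ : V → ZMod l) (T : (ZMod l → V) → ZMod 2) (B : Finset V) : ZMod 2 :=
  ∑ f ∈ Fintype.piFinset (fun c => star (part χ B c)), T f

def Ext (χ : V → ZMod l) (a : ZMod l) (B : Finset V) : Prop :=
  ∃ j : ℕ, 1 ≤ j ∧ j < l ∧ (∑ x ∈ B, χ x) = a - j ∧ ∃ c : ZMod l, ∀ i < j, ∀ y ∈ B, χ y ≠ c + i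

def InF (χ : V → ZMod l) (a : ZMod l) (T : (ZMod l → V) → ZMod 2) (B : Finset V) : Prop :=
  ((∑ x ∈ B, χ x) = a ∧ gg χ T B = 0) ∨ Ext χ a B

lemma exists_gg (χ : V → ZMod l) (T : (ZMod l → V) → ZMod 2) (K : Finset V) (c : ZMod l)
    (h : (part χ K c).Nonempty) : ∃ x ∈ part χ K c, gg χ T (K.erase x) = 0 := by
  obtain ⟨S, hS, hodd, hst⟩ := star_erase _ h
  by_contra! hcon
  have h1 : ∀ x ∈ S, gg χ T (K.erase x) = 1 := by
    intro x hx
    have := hcon x (hS hx)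
    revert this
    generalize gg χ T (K.erase x) = z
    revert z; decide
  set Q := Fintype.piFinset (Function.update (fun d => star (part χ K d)) c univ) with hQ
  have h2 : ∀ x ∈ S, gg χ T (K.erase x) = ∑ f ∈ Q, if f c ∈ S.erase x then T f else 0 := by
    intro x hx
    have hxc : χ x = c := by
      have := hS hx
      simp only [part, mem_filter] at this
      exact this.2
    rw [gg, ← sum_filter]
    apply sum_congr _ (fun _ _ => rfl)
    have hpart : ∀ d, star (part χ (K.erase x) d) =
        if d = c then S.erase x else star (part χ K d) := by
      intro d
      split_ifs with hd
      · subst hd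
        rw [← hst x hx]
        congr 1
        ext z; simp only [part, mem_filter, mem_erase]; tauto
      · congr 1
        ext z; simp only [part, mem_filter, mem_erase]
        constructor
        · tauto
        · rintro ⟨hz, hzd⟩
          refine ⟨⟨?_, hz⟩, hzd⟩
          rintro rfl
          exact hd (hzd.symm.trans hxc)
    ext f
    simp only [hQ, mem_filter, Fintype.mem_piFinset, hpart]
    constructor
    · intro hf
      refine ⟨fun d => ?_, by simpa using hf c⟩
      by_cases hd : d = c
      · subst hd; simp
      · simpa [hd] using hf d
    · rintro ⟨hf, hfc⟩ d
      by_cases hd : d = c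
      · subst hd; simpa using hfc
      · simpa [hd] using hf d
  have h3 : ∑ x ∈ S, gg χ T (K.erase x) = 1 := by
    rw [sum_congr rfl h1]
    simp only [sum_const, nsmul_eq_mul, mul_one]
    exact ZMod.natCast_eq_one_iff_odd.2 hodd
  have h4 : ∑ x ∈ S, gg χ T (K.erase x) = 0 := by
    rw [sum_congr rfl h2, sum_comm]
    apply sum_eq_zero
    intro f _
    by_cases hf : f c ∈ S
    · have : ∀ x ∈ S, (if f c ∈ S.erase x then T f else 0) = if x ∈ S.erase (f c) then T f else 0 := by
        intro x hx
        simp only [mem_erase, hf, hx, and_true]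
        simp only [ne_comm]
      rw [sum_congr rfl this, ← sum_filter]
      have h5 : S.filter (fun x => x ∈ S.erase (f c)) = S.erase (f c) := by
        ext z; simp
      rw [h5, sum_const, nsmul_eq_mul]
      have h6 := card_erase_add_one hf
      have h7 : Even (S.erase (f c)).card := by
        by_contra h2
        rw [← h6] at hodd
        rw [← Nat.not_even_iff_odd] at hodd
        exact hodd (by simp [Nat.even_add_one, h2])
      rw [ZMod.natCast_eq_zero_iff_even.2 h7, zero_mul]
    · apply sum_eq_zero
      intro x _
      simp [hf]
  rw [h3] at h4
  exact absurd h4 (by decide)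

lemma exists_InF (χ : V → ZMod l) (a : ZMod l) (T : (ZMod l → V) → ZMod 2) (K : Finset V)
    (h : K.Nonempty) : ∃ x ∈ K, InF χ a T (K.erase x) := by
  classical
  set c0 := (∑ x ∈ K, χ x) - a with hc0
  have hsum : ∀ x ∈ K, ∑ y ∈ K.erase x, χ y = a + c0 - χ x := by
    intro x hx
    rw [← sum_erase_add _ _ hx] at hc0
    rw [hc0]; ring
  obtain ⟨x0, hx0⟩ := h
  have hP0 : ∃ x ∈ K, χ x = c0 + ((χ x0 - c0).val : ℕ) := ⟨x0, hx0, by simp⟩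
  have hP : ∃ j : ℕ, ∃ x ∈ K, χ x = c0 + (j : ZMod l) := ⟨_, hP0⟩
  have hjl : Nat.find hP < l := lt_of_le_of_lt (Nat.find_min' hP hP0) (ZMod.val_lt _)
  have hmin : ∀ i < Nat.find hP, ∀ y ∈ K, χ y ≠ c0 + (i : ZMod l) := by
    intro i hi y hy he
    exact Nat.find_min hP hi ⟨y, hy, he⟩
  obtain ⟨x, hx, hxj⟩ := Nat.find_spec hP
  by_cases hj : Nat.find hP = 0
  · rw [hj] at hxj
    simp only [Nat.cast_zero, add_zero] at hxj
    obtain ⟨z, hz, hg⟩ := exists_gg χ T K c0 ⟨x, by simp [part, hx, hxj]⟩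
    simp only [part, mem_filter] at hz
    refine ⟨z, hz.1, Or.inl ⟨?_, hg⟩⟩
    rw [hsum z hz.1, hz.2]; ring
  · refine ⟨x, hx, Or.inr ⟨Nat.find hP, by omega, hjl, ?_, c0, ?_⟩⟩
    · rw [hsum x hx, hxj]; ring
    · intro i hi y hy
      exact hmin i hi y (mem_of_mem_erase hy)

def missed (χ : V → ZMod l) (B : Finset V) : Finset (ZMod l) :=
  univ.filter (fun c => ∀ y ∈ B, χ y ≠ c)

def single (χ : V → ZMod l) (B : Finset V) : Finset (ZMod l) :=
  univ.filter (fun c => (part χ B c).card = 1)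

open Classical in
lemma ext_card (χ : V → ZMod l) (B : Finset V) :
    (univ.filter (fun a => Ext χ a B)).card ≤ (missed χ B).card := by
  set J : Finset ℕ := (range l).filter (fun j => 1 ≤ j ∧ ∃ c : ZMod l, ∀ i < j, ∀ y ∈ B, χ y ≠ c + i) with hJ
  have h1 : univ.filter (fun a => Ext χ a B) ⊆ J.image (fun j : ℕ => (∑ x ∈ B, χ x) + (j : ZMod l)) := by
    intro a ha
    simp only [mem_filter, mem_univ, true_and] at ha
    obtain ⟨j, hj1, hjl, hs, hc⟩ := ha
    rw [mem_image]
    refine ⟨j, by simp only [hJ, mem_filter, mem_range]; exact ⟨hjl, hj1, hc⟩, ?_⟩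
    rw [hs]; ring
  refine (card_le_card h1).trans (card_image_le.trans ?_)
  rcases J.eq_empty_or_nonempty with h0 | h0
  · simp [h0]
  · have hm := J.max'_mem h0
    have hsub : J ⊆ Icc 1 (J.max' h0) := by
      intro j hj
      rw [mem_Icc]
      refine ⟨?_, J.le_max' j hj⟩
      simp only [hJ, mem_filter] at hj
      exact hj.2.1
    have hle := card_le_card hsub
    rw [Nat.card_Icc] at hle
    generalize J.max' h0 = j at hm hle
    simp only [hJ, mem_filter, mem_range] at hm
    obtain ⟨hjl, _, c, hc⟩ := hm
    have h2 : (range j).image (fun i : ℕ => c + (i : ZMod l)) ⊆ missed χ B := by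
      intro d hd
      rw [mem_image] at hd
      obtain ⟨i, hi, rfl⟩ := hd
      simp only [missed, mem_filter, mem_univ, true_and]
      exact hc i (mem_range.1 hi)
    have h3 := card_le_card h2
    rw [card_image_of_injOn, card_range] at h3
    · omega
    · intro i hi i' hi' he
      simp only [coe_range, Set.mem_Iio] at hi hi'
      have := add_left_cancel he
      rw [ZMod.natCast_eq_natCast_iff'] at this
      rwa [Nat.mod_eq_of_lt (by omega), Nat.mod_eq_of_lt (by omega)] at this

lemma gg_count (χ : V → ZMod l) (B : Finset V) :
    ((univ.filter (fun T : (ZMod l → V) → ZMod 2 => gg χ T B = 0)).card : ℝ) ≤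
      (Fintype.card ((ZMod l → V) → ZMod 2) : ℝ) *
        (1 / 2 + 1 / 2 * ((missed χ B).card + (single χ B).card)) := by
  have hN : (0 : ℝ) ≤ (Fintype.card ((ZMod l → V) → ZMod 2) : ℝ) := Nat.cast_nonneg _
  by_cases h : ∀ c, (star (part χ B c)).Nonempty
  · choose f0 hf0 using h
    have hf : f0 ∈ Fintype.piFinset (fun c => star (part χ B c)) := by
      rw [Fintype.mem_piFinset]; exact hf0
    have hflip : ∀ T, gg χ (T + Pi.single f0 1) B = gg χ T B + 1 := by
      intro T
      simp only [gg, Pi.add_apply, sum_add_distrib]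
      congr 1
      rw [sum_eq_single f0]
      · simp
      · intro b _ hb; simp [hb]
      · intro hh; exact absurd hf hh
    have heq : (univ.filter (fun T : (ZMod l → V) → ZMod 2 => gg χ T B = 0)).card =
        (univ.filter (fun T : (ZMod l → V) → ZMod 2 => ¬ gg χ T B = 0)).card := by
      apply card_bij (fun T _ => T + Pi.single f0 1)
      · intro T hT
        simp only [mem_filter, mem_univ, true_and] at hT ⊢
        rw [hflip, hT]; decide
      · intro T _ T' _ he
        exact add_right_cancel he
      · intro T hT
        simp only [mem_filter, mem_univ, true_and] at hT
        refine ⟨T - Pi.single f0 1, ?_, by simp⟩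
        simp only [mem_filter, mem_univ, true_and]
        have := hflip (T - Pi.single f0 1)
        rw [sub_add_cancel] at this
        rw [this] at hT
        revert hT
        generalize gg χ (T - Pi.single f0 1) B = z
        revert z; decide
    have htot := card_filter_add_card_filter_not (s := (univ : Finset ((ZMod l → V) → ZMod 2)))
      (fun T => gg χ T B = 0)
    rw [← heq, card_univ] at htot
    rw [← htot]
    push_cast
    have : (0:ℝ) ≤ (missed χ B).card := Nat.cast_nonneg _
    have : (0:ℝ) ≤ (single χ B).card := Nat.cast_nonneg _
    have h0 : (0:ℝ) ≤ (univ.filter (fun T : (ZMod l → V) → ZMod 2 => gg χ T B = 0)).card :=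
      Nat.cast_nonneg _
    nlinarith [mul_nonneg h0 (add_nonneg ‹(0:ℝ) ≤ (missed χ B).card› this)]
  · push Not at h
    obtain ⟨c, hc⟩ := h
    have hle := star_empty _ hc
    have h1 : 1 ≤ (missed χ B).card + (single χ B).card := by
      rcases Nat.le_one_iff_eq_zero_or_eq_one.1 hle with h0 | h0
      · have : c ∈ missed χ B := by
          simp only [missed, mem_filter, mem_univ, true_and]
          rw [card_eq_zero] at h0
          intro y hy he
          have : y ∈ part χ B c := by simp [part, hy, he]
          rw [h0] at this; simp at this
        have := card_pos.2 ⟨c, this⟩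
        omega
      · have : c ∈ single χ B := by
          simp only [single, mem_filter, mem_univ, true_and]; exact h0
        have := card_pos.2 ⟨c, this⟩
        omega
    have h1' : (1:ℝ) ≤ (missed χ B).card + (single χ B).card := by exact_mod_cast h1
    have h2 : ((univ.filter (fun T : (ZMod l → V) → ZMod 2 => gg χ T B = 0)).card : ℝ) ≤
        (Fintype.card ((ZMod l → V) → ZMod 2) : ℝ) := by
      exact_mod_cast card_le_univ _
    nlinarith [mul_le_mul_of_nonneg_left h1' hN]

open Classical in
lemma fixed_chi (χ : V → ZMod l) (B : Finset V) :
    (∑ a : ZMod l, ∑ T : (ZMod l → V) → ZMod 2, if InF χ a T B then (1:ℝ) else 0) ≤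
      (Fintype.card ((ZMod l → V) → ZMod 2) : ℝ) *
        (1 / 2 + 3 / 2 * (missed χ B).card + 1 / 2 * (single χ B).card) := by
  have h1 : (∑ a : ZMod l, ∑ T : (ZMod l → V) → ZMod 2, if InF χ a T B then (1:ℝ) else 0) ≤
      ∑ a : ZMod l, ∑ T : (ZMod l → V) → ZMod 2,
        ((if (∑ x ∈ B, χ x) = a then (if gg χ T B = 0 then (1:ℝ) else 0) else 0) +
          (if Ext χ a B then (1:ℝ) else 0)) := by
    apply sum_le_sum; intro a _
    apply sum_le_sum; intro T _
    unfold InF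
    by_cases h1 : (∑ x ∈ B, χ x) = a <;> by_cases h2 : gg χ T B = 0 <;>
      by_cases h3 : Ext χ a B <;> simp [h1, h2, h3]
  refine h1.trans ?_
  simp only [sum_add_distrib]
  have h2 : (∑ a : ZMod l, ∑ T : (ZMod l → V) → ZMod 2,
      (if (∑ x ∈ B, χ x) = a then (if gg χ T B = 0 then (1:ℝ) else 0) else 0)) =
      ((univ.filter (fun T : (ZMod l → V) → ZMod 2 => gg χ T B = 0)).card : ℝ) := by
    rw [sum_comm]
    simp [sum_boole]
  have h3 : (∑ a : ZMod l, ∑ T : (ZMod l → V) → ZMod 2, (if Ext χ a B then (1:ℝ) else 0)) =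
      (Fintype.card ((ZMod l → V) → ZMod 2) : ℝ) * (univ.filter (fun a => Ext χ a B)).card := by
    rw [sum_comm, sum_const, nsmul_eq_mul, card_univ, sum_boole]
  rw [h2, h3]
  have h4 := gg_count χ B
  have h5 : ((univ.filter (fun a => Ext χ a B)).card : ℝ) ≤ (missed χ B).card := by
    exact_mod_cast ext_card χ B
  have hN : (0 : ℝ) ≤ (Fintype.card ((ZMod l → V) → ZMod 2) : ℝ) := Nat.cast_nonneg _
  nlinarith [mul_le_mul_of_nonneg_left h5 hN]

lemma prod_count (B : Finset V) (q : ℝ) :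
    ∏ x : V, (if x ∈ B then q else (1:ℝ)) = q ^ B.card := by
  rw [prod_ite_mem]; simp

lemma miss_count (B : Finset V) (c : ZMod l) :
    ((univ.filter (fun χ : V → ZMod l => ∀ y ∈ B, χ y ≠ c)).card : ℝ) =
      (l : ℝ) ^ Fintype.card V * (1 - 1 / (l : ℝ)) ^ B.card := by
  have hl0 : (l : ℝ) ≠ 0 := Nat.cast_ne_zero.2 (NeZero.ne l)
  have h1 : univ.filter (fun χ : V → ZMod l => ∀ y ∈ B, χ y ≠ c) =
      Fintype.piFinset (fun y => if y ∈ B then univ.erase c else univ) := by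
    ext χ
    simp only [mem_filter, mem_univ, true_and, Fintype.mem_piFinset]
    constructor
    · intro h y
      split_ifs with hy
      · simpa using h y hy
      · simp
    · intro h y hy
      simpa [hy] using h y
  rw [h1, Fintype.card_piFinset]
  push_cast
  rw [← prod_count, ← card_univ, ← prod_const, ← prod_mul_distrib]
  apply prod_congr rfl
  intro x _
  split_ifs
  · rw [card_erase_of_mem (mem_univ _), card_univ, ZMod.card,
      Nat.cast_sub (Nat.one_le_iff_ne_zero.2 (NeZero.ne l))]
    field_simp; simp
  · simp [ZMod.card]

lemma single_count (B : Finset V) (c : ZMod l) :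
    ((univ.filter (fun χ : V → ZMod l => (part χ B c).card = 1)).card : ℝ) ≤
      (l : ℝ) ^ Fintype.card V * (B.card * (1 / (l : ℝ) * (1 - 1 / (l : ℝ)) ^ (B.card - 1))) := by
  have hl0 : (l : ℝ) ≠ 0 := Nat.cast_ne_zero.2 (NeZero.ne l)
  set P : V → Finset (V → ZMod l) := fun x => Fintype.piFinset
    (fun y => if y = x then {c} else if y ∈ B.erase x then univ.erase c else univ) with hP
  have h1 : univ.filter (fun χ : V → ZMod l => (part χ B c).card = 1) ⊆ B.biUnion P := by
    intro χ hχ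
    simp only [mem_filter, mem_univ, true_and] at hχ
    obtain ⟨x, hx⟩ := card_eq_one.1 hχ
    have hxm : ∀ y, (y ∈ B ∧ χ y = c) ↔ y = x := by
      intro y
      have : y ∈ part χ B c ↔ y ∈ ({x} : Finset V) := by rw [hx]
      simpa [part] using this
    rw [mem_biUnion]
    refine ⟨x, ((hxm x).2 rfl).1, ?_⟩
    simp only [hP, Fintype.mem_piFinset]
    intro y
    split_ifs with h1 h2
    · simpa using ((hxm y).2 h1).2
    · rw [mem_erase] at h2 ⊢
      exact ⟨fun he => h1 ((hxm y).1 ⟨h2.2, he⟩), mem_univ _⟩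
    · simp
  have h2 : ∀ x ∈ B, ((P x).card : ℝ) =
      (l : ℝ) ^ Fintype.card V * (1 / (l : ℝ) * (1 - 1 / (l : ℝ)) ^ (B.card - 1)) := by
    intro x hx
    rw [hP]
    simp only
    rw [Fintype.card_piFinset]
    push_cast
    have : (1 / (l:ℝ)) = ∏ y : V, (if y = x then (1 / (l:ℝ)) else 1) := by
      rw [prod_ite_eq']; simp
    rw [← card_erase_of_mem hx]
    rw [← prod_count]
    nth_rewrite 1 [this]
    rw [← card_univ, ← prod_const, ← prod_mul_distrib, ← prod_mul_distrib]
    apply prod_congr rfl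
    intro y _
    by_cases h1 : y = x
    · subst h1
      simp [hl0]
    · by_cases h2 : y ∈ B.erase x
      · rw [if_neg h1, if_pos h2, if_neg h1, if_pos h2, card_erase_of_mem (mem_univ _), card_univ,
          ZMod.card, Nat.cast_sub (Nat.one_le_iff_ne_zero.2 (NeZero.ne l))]
        field_simp; simp
      · rw [if_neg h1, if_neg h2, if_neg h1, if_neg h2]
        simp [ZMod.card]
  calc ((univ.filter (fun χ : V → ZMod l => (part χ B c).card = 1)).card : ℝ)
      ≤ ((∑ x ∈ B, (P x).card : ℕ) : ℝ) := by
        exact_mod_cast (card_le_card h1).trans card_biUnion_le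
    _ = _ := by
        push_cast
        rw [sum_congr rfl h2, sum_const, nsmul_eq_mul]; ring

lemma sum_missed (B : Finset V) :
    (∑ χ : V → ZMod l, ((missed χ B).card : ℝ)) =
      (l : ℝ) * ((l : ℝ) ^ Fintype.card V * (1 - 1 / (l : ℝ)) ^ B.card) := by
  have : ∀ χ : V → ZMod l, ((missed χ B).card : ℝ) =
      ∑ c : ZMod l, if (∀ y ∈ B, χ y ≠ c) then (1:ℝ) else 0 := by
    intro χ; rw [sum_boole]; rfl
  simp only [this]
  rw [sum_comm]
  simp only [sum_boole, miss_count]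
  simp [ZMod.card]

lemma sum_single (B : Finset V) :
    (∑ χ : V → ZMod l, ((single χ B).card : ℝ)) ≤
      (l : ℝ) * ((l : ℝ) ^ Fintype.card V *
        (B.card * (1 / (l : ℝ) * (1 - 1 / (l : ℝ)) ^ (B.card - 1)))) := by
  have : ∀ χ : V → ZMod l, ((single χ B).card : ℝ) =
      ∑ c : ZMod l, if (part χ B c).card = 1 then (1:ℝ) else 0 := by
    intro χ; rw [sum_boole]; rfl
  simp only [this]
  rw [sum_comm]
  simp only [sum_boole]
  refine (sum_le_sum (fun c _ => single_count B c)).trans ?_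
  simp [ZMod.card]

open Classical in
lemma total (B : Finset V) (hl : 2 ≤ l) (hB : 1 ≤ B.card) :
    (∑ χ : V → ZMod l, ∑ a : ZMod l, ∑ T : (ZMod l → V) → ZMod 2,
      if InF χ a T B then (1:ℝ) else 0) ≤
      (Fintype.card ((V → ZMod l) × ZMod l × ((ZMod l → V) → ZMod 2)) : ℝ) *
      (1 / (2 * (l:ℝ)) + 1 / 2 * (3 + (B.card : ℝ) / (l - 1)) * (1 - 1 / (l:ℝ)) ^ B.card) := by
  refine (sum_le_sum (fun χ _ => fixed_chi χ B)).trans ?_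
  rw [← mul_sum, sum_add_distrib, sum_add_distrib, ← mul_sum, ← mul_sum, sum_missed]
  have h := sum_single (l := l) B
  have hl2 : (2:ℝ) ≤ l := by exact_mod_cast hl
  have hl1 : (l:ℝ) - 1 ≠ 0 := by linarith
  have hl0 : (l:ℝ) ≠ 0 := by linarith
  rw [Fintype.card_prod, Fintype.card_prod, Fintype.card_fun (α := V), ZMod.card, sum_const, card_univ,
    Fintype.card_fun (α := V), ZMod.card, nsmul_eq_mul]
  generalize hNT : Fintype.card ((ZMod l → V) → ZMod 2) = NT
  obtain ⟨k, hk⟩ : ∃ k, B.card = k + 1 := ⟨B.card - 1, by omega⟩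
  rw [hk] at h ⊢
  simp only [Nat.add_sub_cancel] at h
  push_cast at h ⊢
  generalize (∑ χ : V → ZMod l, ((single χ B).card : ℝ)) = s at h
  have e : ((l:ℝ) ^ Fintype.card V * (l * NT)) *
      (1 / (2 * (l:ℝ)) + 1 / 2 * (3 + ((k:ℝ) + 1) / (l - 1)) * (1 - 1 / (l:ℝ)) ^ (k+1)) =
      NT * ((l:ℝ) ^ Fintype.card V * (1 / 2) + 3 / 2 * (l * ((l:ℝ) ^ Fintype.card V * (1 - 1 / (l:ℝ)) ^ (k+1)))
       + 1 / 2 * (l * ((l:ℝ) ^ Fintype.card V * (((k:ℝ)+1) * (1 / l * (1 - 1 / (l:ℝ)) ^ k))))) := by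
    have : (1 - 1 / (l:ℝ)) = (l - 1) / l := by field_simp
    rw [this, pow_succ]
    field_simp
    ring
  rw [e]
  gcongr

theorem turan_aux (L : Finset V) (r : ℕ) (hl : 2 ≤ l) (hr : 1 ≤ r) :
    ∃ F ⊆ L.powersetCard r, (∀ K ⊆ L, K.card = r + 1 → ∃ D ∈ F, D ⊆ K) ∧
      (F.card : ℝ) ≤ (1 / (2 * (l:ℝ)) + 1 / 2 * (3 + (r : ℝ) / (l - 1)) * (1 - 1 / (l:ℝ)) ^ r) *
        (L.card.choose r : ℝ) := by
  classical
  rcases isEmpty_or_nonempty V with hV | hV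
  · refine ⟨∅, by simp, ?_, ?_⟩
    · intro K _ hK
      rw [Finset.eq_empty_of_isEmpty K] at hK
      simp at hK
    · have hl2 : (2:ℝ) ≤ l := by exact_mod_cast hl
      have : (0:ℝ) ≤ 1 - 1 / (l:ℝ) := by
        rw [sub_nonneg, div_le_one (by linarith)]; linarith
      have h1 : (0:ℝ) ≤ (l:ℝ) - 1 := by linarith
      simp only [card_empty, Nat.cast_zero]
      positivity
  set Ω := (V → ZMod l) × ZMod l × ((ZMod l → V) → ZMod 2)
  set F : Ω → Finset (Finset V) := fun p => (L.powersetCard r).filter (fun B => InF p.1 p.2.1 p.2.2 B) with hF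
  set b : ℝ := (1 / (2 * (l:ℝ)) + 1 / 2 * (3 + (r : ℝ) / (l - 1)) * (1 - 1 / (l:ℝ)) ^ r) *
        (L.card.choose r : ℝ) with hb
  have hsum : ∑ p : Ω, ((F p).card : ℝ) ≤ ∑ p : Ω, b := by
    have h1 : ∀ p : Ω, ((F p).card : ℝ) =
        ∑ B ∈ L.powersetCard r, if InF p.1 p.2.1 p.2.2 B then (1:ℝ) else 0 := by
      intro p; rw [sum_boole]
    simp only [h1]
    rw [sum_comm]
    have h2 : ∀ B ∈ L.powersetCard r, (∑ p : Ω, if InF p.1 p.2.1 p.2.2 B then (1:ℝ) else 0) ≤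
        (Fintype.card Ω : ℝ) *
      (1 / (2 * (l:ℝ)) + 1 / 2 * (3 + (r : ℝ) / (l - 1)) * (1 - 1 / (l:ℝ)) ^ r) := by
      intro B hB
      have hc := (mem_powersetCard.1 hB).2
      have := total (l := l) B hl (by omega)
      rw [hc] at this
      refine le_trans (le_of_eq ?_) this
      rw [Fintype.sum_prod_type]
      apply sum_congr rfl; intro χ _
      rw [Fintype.sum_prod_type]
    refine (sum_le_sum h2).trans (le_of_eq ?_)
    rw [sum_const, sum_const, card_powersetCard, card_univ, hb]
    simp only [nsmul_eq_mul]
    ring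
  obtain ⟨p, _, hp⟩ := exists_le_of_sum_le (s := (univ : Finset Ω)) univ_nonempty hsum
  refine ⟨F p, filter_subset _ _, ?_, hp⟩
  intro K hK hc
  obtain ⟨x, hx, hin⟩ := exists_InF p.1 p.2.1 p.2.2 K (card_pos.1 (by omega))
  refine ⟨K.erase x, ?_, erase_subset _ _⟩
  rw [hF, mem_filter, mem_powersetCard]
  refine ⟨⟨(erase_subset _ _).trans hK, ?_⟩, hin⟩
  rw [card_erase_of_mem hx, hc]; rfl

end turan

end SEProof

namespace SEProof
open Finset

def low (n M : ℕ) : Finset (Fin n) := univ.filter (fun x => x.val < M)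

lemma low_card (n M : ℕ) (h : M ≤ n) : (low n M).card = M := by
  rw [low, Fin.card_filter_val_lt]; omega

/-- Decomposition: Turán systems on initial segments give a single-exclusion system. -/
lemma decomp (n t m : ℕ) (hm : 1 ≤ m) (hn : n = m + t + 1)
    (F : ℕ → Finset (Finset (Fin n)))
    (hF : ∀ i ≤ t, F i ⊆ (low n (m + i)).powersetCard i)
    (hT : ∀ i ≤ t, ∀ K ⊆ low n (m + i), K.card = i + 1 → ∃ D ∈ F i, D ⊆ K) :
    SENumber n t ≤ ∑ i ∈ range (t + 1), (F i).card := by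
  classical
  set hi : ℕ → Finset (Fin n) := fun i => univ.filter (fun x => m + i < x.val) with hhi
  set S : Finset (Finset (Fin n)) :=
    (range (t + 1)).biUnion (fun i => (F i).image (fun D => D ∪ hi i)) with hS
  have hle : S.card ≤ ∑ i ∈ range (t + 1), (F i).card :=
    card_biUnion_le.trans (sum_le_sum (fun i _ => card_image_le))
  refine le_trans (Nat.sInf_le ⟨S, ?_, rfl⟩) hle
  have hmemS : ∀ i ≤ t, ∀ D ∈ F i, D ∪ hi i ∈ S := by
    intro i hit D hD
    rw [hS, mem_biUnion]
    exact ⟨i, by simp; omega, mem_image_of_mem _ hD⟩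
  constructor
  · intro B hB
    rw [hS, mem_biUnion] at hB
    obtain ⟨i, hi1, hB⟩ := hB
    rw [mem_image] at hB
    obtain ⟨D, hD, rfl⟩ := hB
    have hit : i ≤ t := by simp at hi1; omega
    obtain ⟨hDl, hDc⟩ := mem_powersetCard.1 (hF i hit hD)
    rw [card_union_of_disjoint, hDc]
    · have h1 := card_filter_add_card_filter_not (s := (univ : Finset (Fin n)))
        (fun x => x.val < m + i + 1)
      have h2 := low_card n (m + i + 1) (by omega)
      have h3 : univ.filter (fun x : Fin n => ¬ x.val < m + i + 1) = hi i := by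
        rw [hhi]; ext x; simp only [mem_filter, mem_univ, true_and]; omega
      rw [h3, card_univ, Fintype.card_fin] at h1
      rw [low] at h2
      omega
    · rw [disjoint_left]
      intro x hx hx2
      have := hDl hx
      simp only [low, hhi, mem_filter, mem_univ, true_and] at this hx2
      omega
  · intro X hX1 hXt
    have hFne : ∀ i ≤ t, (F i).Nonempty := by
      intro i hit
      obtain ⟨K, hK, hKc⟩ := exists_subset_card_eq (s := low n (m + i)) (n := i + 1)
        (by rw [low_card n _ (by omega)]; omega)
      obtain ⟨D, hD, _⟩ := hT i hit K hK hKc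
      exact ⟨D, hD⟩
    by_cases hex : ∃ i, i ≤ t ∧ i + 1 ≤ (X ∩ low n (m + i)).card
    · obtain ⟨i0, hi0⟩ := hex
      set i := Nat.findGreatest (fun i => i ≤ t ∧ i + 1 ≤ (X ∩ low n (m + i)).card) t with hidef
      have hspec : i ≤ t ∧ i + 1 ≤ (X ∩ low n (m + i)).card :=
        Nat.findGreatest_spec (P := fun i => i ≤ t ∧ i + 1 ≤ (X ∩ low n (m + i)).card) hi0.1 hi0
      have hnext : (X ∩ low n (m + (i + 1))).card ≤ i + 1 := by
        by_cases hit : i + 1 ≤ t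
        · by_contra hcon
          have := Nat.le_findGreatest (P := fun i => i ≤ t ∧ i + 1 ≤ (X ∩ low n (m + i)).card)
            hit ⟨hit, by omega⟩
          omega
        · have := card_le_card (inter_subset_left (s₁ := X) (s₂ := low n (m + (i + 1))))
          omega
      clear_value i
      have hsub : X ∩ low n (m + i) ⊆ X ∩ low n (m + (i + 1)) := by
        intro x hx
        simp only [low, mem_inter, mem_filter, mem_univ, true_and] at hx ⊢
        exact ⟨hx.1, by omega⟩
      have heq := eq_of_subset_of_card_le hsub (by omega)
      have hc : (X ∩ low n (m + i)).card = i + 1 := by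
        rw [← heq] at hnext; omega
      obtain ⟨D, hD, hDK⟩ := hT i hspec.1 _ inter_subset_right hc
      have hDc := (mem_powersetCard.1 (hF i hspec.1 hD)).2
      refine ⟨_, hmemS i hspec.1 D hD, ?_⟩
      have hd : X \ (D ∪ hi i) = (X ∩ low n (m + i)) \ D := by
        ext x
        have hx := congrArg (fun s => x ∈ s) heq
        simp only [low, mem_inter, mem_filter, mem_univ, true_and, eq_iff_iff] at hx
        simp only [hhi, low, mem_sdiff, mem_union, mem_inter, mem_filter, mem_univ, true_and, not_or]
        constructor
        · rintro ⟨h1, h2, h3⟩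
          exact ⟨hx.2 ⟨h1, by omega⟩, h2⟩
        · rintro ⟨⟨h1, h3⟩, h2⟩
          exact ⟨h1, h2, by omega⟩
      rw [hd, card_sdiff_of_subset hDK, hc, hDc]; omega
    · push Not at hex
      have hne : X.Nonempty := card_pos.1 (by omega)
      set x := X.min' hne with hx
      have hxX : x ∈ X := X.min'_mem hne
      have hmin : ∀ y ∈ X, x.val ≤ y.val := fun y hy => X.min'_le y hy
      have hxm : m ≤ x.val := by
        have := hex 0 (by omega)
        by_contra hcon
        have h2 : x ∈ X ∩ low n (m + 0) := by
          simp only [low, mem_inter, mem_filter, mem_univ, true_and]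
          exact ⟨hxX, by omega⟩
        have := card_pos.2 ⟨x, h2⟩
        omega
      have hxn := x.isLt
      clear_value x
      obtain ⟨i, hi'⟩ : ∃ i, x.val = m + i := ⟨x.val - m, by omega⟩
      have hit : i ≤ t := by omega
      obtain ⟨D, hD⟩ := hFne i hit
      have hDl := (mem_powersetCard.1 (hF i hit hD)).1
      refine ⟨_, hmemS i hit D hD, card_eq_one.2 ⟨x, ?_⟩⟩
      ext y
      simp only [hhi, mem_sdiff, mem_union, mem_filter, mem_univ, true_and, not_or, mem_singleton]
      constructor
      · rintro ⟨h1, h2, h3⟩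
        have := hmin y h1
        exact Fin.ext (by omega)
      · rintro rfl
        refine ⟨hxX, fun h => ?_, by omega⟩
        have := hDl h
        simp only [low, mem_filter, mem_univ, true_and] at this
        omega

lemma turan_final (n m i l : ℕ) (hmn : m + i ≤ n) (hm : 1 ≤ m) (hl : 0 < l)
    (hpos : 0 < (l : ℝ) - 1 - (l : ℝ) * ((i : ℝ) - 1) / ((m : ℝ) + i)) :
    ∃ F ⊆ (low n (m + i)).powersetCard i,
      (∀ K ⊆ low n (m + i), K.card = i + 1 → ∃ D ∈ F, D ⊆ K) ∧
      (F.card : ℝ) ≤ (1 / (2 * (l : ℝ)) +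
        (1 / 2) * (3 + (i : ℝ) /
            ((l : ℝ) - 1 - (l : ℝ) * ((i : ℝ) - 1) / ((m : ℝ) + i))) *
          (1 - 1 / (l : ℝ)) ^ i) * ((m + i).choose i : ℝ) := by
  have hlr : (1:ℝ) ≤ l := by exact_mod_cast hl
  have hmr : (1:ℝ) ≤ m := by exact_mod_cast hm
  rcases Nat.eq_zero_or_pos i with rfl | hi
  · refine ⟨{∅}, by simp, ?_, ?_⟩
    · intro K _ _
      exact ⟨∅, by simp, by simp⟩
    · have : (0:ℝ) < 1 / (2 * (l:ℝ)) := by positivity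
      simp only [card_singleton, Nat.cast_one, Nat.cast_zero, zero_div, add_zero, pow_zero,
        Nat.choose_zero_right, mul_one]
      linarith
  · have hir : (1:ℝ) ≤ i := by exact_mod_cast hi
    have hq : 0 ≤ (l : ℝ) * ((i : ℝ) - 1) / ((m : ℝ) + i) := by
      have : 0 ≤ (i:ℝ) - 1 := by linarith
      positivity
    have hl2 : 2 ≤ l := by
      by_contra hcon
      have : l = 1 := by omega
      subst this
      norm_num at hpos hq
      linarith
    have : NeZero l := ⟨by omega⟩
    obtain ⟨F, hF, hT, hc⟩ := turan_aux (l := l) (low n (m + i)) i hl2 hi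
    refine ⟨F, hF, hT, hc.trans ?_⟩
    rw [low_card n _ hmn]
    have h0 : (0:ℝ) ≤ 1 - 1 / (l:ℝ) := by
      rw [sub_nonneg, div_le_one (by linarith)]; linarith
    have h1 : (l : ℝ) - 1 - (l : ℝ) * ((i : ℝ) - 1) / ((m : ℝ) + i) ≤ l - 1 := by linarith
    gcongr

end SEProof

theorem stmt11 (n t : ℕ) (ht : 0 < t) (htn : t + 1 < n) (l : ℕ → ℕ)
    (hl : ∀ i ≤ t, 0 < l i)
    (hpos : ∀ i ≤ t,
      0 < (l i : ℝ) - 1 - (l i : ℝ) * ((i : ℝ) - 1) / (((n : ℝ) - t - 1) + i)) :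
    (SENumber n t : ℝ) ≤ ∑ i ∈ Finset.range (t + 1),
      (1 / (2 * (l i : ℝ)) +
        (1 / 2) * (3 + (i : ℝ) /
            ((l i : ℝ) - 1 - (l i : ℝ) * ((i : ℝ) - 1) / (((n : ℝ) - t - 1) + i))) *
          (1 - 1 / (l i : ℝ)) ^ i) * ((n - t - 1 + i).choose i : ℝ) := by
  obtain ⟨m, hm⟩ : ∃ m, n = m + t + 1 := ⟨n - t - 1, by omega⟩
  have hm1 : 1 ≤ m := by omega
  have e1 : (n : ℝ) - t - 1 = m := by rw [hm]; push_cast; ring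
  have e2 : n - t - 1 = m := by omega
  rw [e1] at hpos
  rw [e1, e2]
  have key : ∀ i, ∃ F : Finset (Finset (Fin n)), i ≤ t →
      (F ⊆ (SEProof.low n (m + i)).powersetCard i ∧
      (∀ K ⊆ SEProof.low n (m + i), K.card = i + 1 → ∃ D ∈ F, D ⊆ K) ∧
      (F.card : ℝ) ≤ (1 / (2 * (l i : ℝ)) +
        (1 / 2) * (3 + (i : ℝ) /
            ((l i : ℝ) - 1 - (l i : ℝ) * ((i : ℝ) - 1) / ((m : ℝ) + i))) *
          (1 - 1 / (l i : ℝ)) ^ i) * ((m + i).choose i : ℝ)) := by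
    intro i
    by_cases hi : i ≤ t
    · obtain ⟨F, h⟩ := SEProof.turan_final n m i (l i) (by omega) hm1 (hl i hi) (hpos i hi)
      exact ⟨F, fun _ => h⟩
    · exact ⟨∅, fun h => absurd h hi⟩
  choose F hF using key
  have h := SEProof.decomp n t m hm1 hm F (fun i hi => (hF i hi).1) (fun i hi => (hF i hi).2.1)
  calc (SENumber n t : ℝ) ≤ ((∑ i ∈ Finset.range (t + 1), (F i).card : ℕ) : ℝ) := by
        exact_mod_cast h
    _ ≤ _ := by
        push_cast
        apply Finset.sum_le_sum
        intro i hi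
        exact (hF i (by simp at hi; omega)).2.2
end

section
/- For every integer n ≥ 6, the (n,3)-single-exclusion number equals the (n,4,3)-Turán number: S(n,3) = T(n,4,3). -/
/-- An `(n,s,t)`-Turán system: a collection of `t`-subsets (blocks) of an `n`-set
such that every `s`-subset contains at least one block. -/
def IsTuranSystem (n s t : ℕ) (T : Finset (Finset (Fin n))) : Prop :=
  (∀ B ∈ T, B.card = t) ∧
  ∀ X : Finset (Fin n), X.card = s → ∃ B ∈ T, B ⊆ X

/-- The `(n,s,t)`-Turán number `T(n,s,t)`: the least number of blocks in an
`(n,s,t)`-Turán system. -/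
noncomputable def turanNumber (n s t : ℕ) : ℕ :=
  sInf {m : ℕ | ∃ T : Finset (Finset (Fin n)), IsTuranSystem n s t T ∧ T.card = m}


theorem turan_erase {n : ℕ} {T : Finset (Finset (Fin n))} (hT : IsTuranSystem n 4 3 T)
    (X : Finset (Fin n)) (hX : X.card = 4) : ∃ u ∈ X, X.erase u ∈ T := by
  obtain ⟨B, hB, hBX⟩ := hT.2 X hX
  have hc := hT.1 B hB
  have h1 : (X \ B).card = 1 := by
    rw [Finset.card_sdiff_of_subset hBX]; omega
  obtain ⟨u, hu⟩ := Finset.card_eq_one.mp h1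
  have huX : u ∈ X ∧ u ∉ B := by
    rw [← Finset.mem_sdiff, hu]; simp
  refine ⟨u, huX.1, ?_⟩
  have : X.erase u = B := by
    rw [Finset.erase_eq, ← hu, Finset.sdiff_sdiff_eq_self hBX]
  rwa [this]

theorem se_turan {n : ℕ} {T : Finset (Finset (Fin n))} (hT : IsSESystem n 3 T) :
    IsTuranSystem n 4 3 T := by
  refine ⟨hT.1, fun X hX => ?_⟩
  obtain ⟨B, hB, h1⟩ := hT.2 X (by omega) (by omega)
  refine ⟨B, hB, ?_⟩
  have hc := hT.1 B hB
  have h2 := Finset.card_inter_add_card_sdiff X B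
  have h3 : X ∩ B = B := Finset.eq_of_subset_of_card_le Finset.inter_subset_right (by omega)
  rw [← h3]; exact Finset.inter_subset_left

theorem pair_bad {n : ℕ} (hn : 6 ≤ n) {T : Finset (Finset (Fin n))}
    (hT : IsTuranSystem n 4 3 T) (x y : Fin n) (hxy : x ≠ y)
    (hbad : ∀ B ∈ T, (x ∈ B ↔ y ∈ B)) :
    ∃ T', IsTuranSystem n 4 3 T' ∧ T'.card < T.card := by
  classical
  have hA : ∀ B : Finset (Fin n), B.card = 3 → x ∉ B → y ∉ B → B ∈ T := by
    intro B hB hx hy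
    obtain ⟨u, hu, h⟩ := turan_erase hT (insert x B) (by rw [Finset.card_insert_of_notMem hx, hB])
    have := hbad _ h
    have hux : u = x := by grind
    subst hux
    rwa [Finset.erase_insert hx] at h
  have hcd : ∀ c d : Fin n, c ≠ d → c ≠ x → c ≠ y → d ≠ x → d ≠ y →
      ({x, y, c} : Finset (Fin n)) ∈ T ∨ ({x, y, d} : Finset (Fin n)) ∈ T := by
    intro c d h1 h2 h3 h4 h5
    obtain ⟨u, hu, h⟩ := turan_erase hT {x, y, c, d} (by grind)
    have := hbad _ h
    have hu' : u = c ∨ u = d := by grind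
    rcases hu' with rfl | rfl
    · right
      convert h using 1
      grind
    · left
      convert h using 1
      grind
  have ha : ∃ a, a ≠ x ∧ a ≠ y ∧ ∀ c, c ≠ a → c ≠ x → c ≠ y → ({x, y, c} : Finset (Fin n)) ∈ T := by
    by_cases he : ∃ a, a ≠ x ∧ a ≠ y ∧ ({x, y, a} : Finset (Fin n)) ∉ T
    · obtain ⟨a, h1, h2, h3⟩ := he
      refine ⟨a, h1, h2, fun c hc hcx hcy => ?_⟩
      exact (hcd c a hc hcx hcy h1 h2).resolve_right h3
    · push Not at he
      have : ∃ a, a ∉ ({x, y} : Finset (Fin n)) := by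
        by_contra! hcon
        have h1 : Finset.univ ⊆ ({x, y} : Finset (Fin n)) := fun a _ => hcon a
        have h2 := Finset.card_le_card h1
        have h3 : ({x, y} : Finset (Fin n)).card ≤ 2 := Finset.card_le_two
        simp at h2; omega
      obtain ⟨a, ha⟩ := this
      exact ⟨a, by grind, by grind, fun c _ h1 h2 => he c h1 h2⟩
  obtain ⟨a, hax, hay, hac⟩ := ha
  have : ∃ b, b ∉ ({x, y, a} : Finset (Fin n)) := by
    by_contra! hcon
    have h1 : Finset.univ ⊆ ({x, y, a} : Finset (Fin n)) := fun a _ => hcon a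
    have h2 := Finset.card_le_card h1
    have h3 : ({x, y, a} : Finset (Fin n)).card ≤ 3 := Finset.card_le_three
    simp at h2; omega
  obtain ⟨b, hb⟩ := this
  have hbx : b ≠ x := by grind
  have hby : b ≠ y := by grind
  have hba : b ≠ a := by grind
  set C : Finset (Fin n) := Finset.univ \ {x, y, a, b} with hC
  have hCc : C.card = n - 4 := by
    rw [hC, Finset.card_sdiff_of_subset (Finset.subset_univ _)]
    have : ({x, y, a, b} : Finset (Fin n)).card = 4 := by grind
    simp [this]
  set R : Finset (Finset (Fin n)) := insert {x, y, b} (C.image (fun c => {a, b, c})) with hR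
  have hRc : R.card = n - 3 := by
    rw [hR, Finset.card_insert_of_notMem, Finset.card_image_of_injOn, hCc]
    · omega
    · intro c hc d hd h
      simp only [Finset.coe_sdiff, hC] at hc hd
      have : c ∈ ({a, b, d} : Finset (Fin n)) := by
        have h' : ({a, b, c} : Finset (Fin n)) = {a, b, d} := h
        rw [← h']; simp
      simp at this hc hd
      tauto
    · intro h
      obtain ⟨c, hc, h⟩ := Finset.mem_image.mp h
      have : a ∈ ({x, y, b} : Finset (Fin n)) := by rw [← h]; simp
      grind
  have hRT : R ⊆ T := by
    intro B hB
    rcases Finset.mem_insert.mp hB with rfl | hB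
    · exact hac b hba hbx hby
    · obtain ⟨c, hc, rfl⟩ := Finset.mem_image.mp hB
      have : c ≠ x ∧ c ≠ y ∧ c ≠ a ∧ c ≠ b := by
        simp [hC] at hc; tauto
      apply hA <;> grind
  have hRb : ∀ B ∈ R, b ∈ B := by
    intro B hB
    rcases Finset.mem_insert.mp hB with rfl | hB
    · simp
    · obtain ⟨c, hc, rfl⟩ := Finset.mem_image.mp hB
      simp
  refine ⟨insert {x, a, b} (insert {y, a, b} (T \ R)), ⟨?_, ?_⟩, ?_⟩
  · intro B hB
    simp only [Finset.mem_insert, Finset.mem_sdiff] at hB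
    rcases hB with rfl | rfl | hB
    · grind
    · grind
    · exact hT.1 B hB.1
  · intro X hX
    have key : ∀ B ∈ T, b ∉ B → B ⊆ X →
        ∃ B ∈ insert {x, a, b} (insert {y, a, b} (T \ R)), B ⊆ X := by
      intro B hB hbB hBX
      refine ⟨B, ?_, hBX⟩
      simp only [Finset.mem_insert, Finset.mem_sdiff]
      exact Or.inr (Or.inr ⟨hB, fun h => hbB (hRb B h)⟩)
    by_cases hbX : b ∈ X
    swap
    · obtain ⟨B, hB, hBX⟩ := hT.2 X hX
      exact key B hB (fun h => hbX (hBX h)) hBX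
    by_cases hxX : x ∈ X
    · by_cases haX : a ∈ X
      · exact ⟨{x, a, b}, by simp, by grind⟩
      by_cases hyX : y ∈ X
      · have : (X \ {x, y, b}).card = 1 := by
          rw [Finset.card_sdiff_of_subset (by grind)]
          have : ({x, y, b} : Finset (Fin n)).card = 3 := by grind
          omega
        obtain ⟨c, hc⟩ := Finset.card_eq_one.mp this
        have hc' : c ∈ X \ {x, y, b} := by rw [hc]; simp
        simp only [Finset.mem_sdiff, Finset.mem_insert, Finset.mem_singleton] at hc'
        refine key {x, y, c} (hac c ?_ ?_ ?_) ?_ ?_ <;> grind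
      · refine ⟨X.erase x, ?_, Finset.erase_subset _ _⟩
        have : X.erase x ∈ T := hA _ (by grind) (by grind) (by grind)
        have h2 : X.erase x ∉ R := by
          intro h
          rcases Finset.mem_insert.mp h with h | h
          · have : x ∈ X.erase x := by rw [h]; simp
            simp at this
          · obtain ⟨c, hc, h⟩ := Finset.mem_image.mp h
            have : a ∈ X.erase x := by rw [← h]; simp
            grind
        simp [this, h2]
    · by_cases hyX : y ∈ X
      · by_cases haX : a ∈ X
        · exact ⟨{y, a, b}, by simp, by grind⟩
        refine ⟨X.erase y, ?_, Finset.erase_subset _ _⟩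
        have : X.erase y ∈ T := hA _ (by grind) (by grind) (by grind)
        have h2 : X.erase y ∉ R := by
          intro h
          rcases Finset.mem_insert.mp h with h | h
          · have : y ∈ X.erase y := by rw [h]; simp
            simp at this
          · obtain ⟨c, hc, h⟩ := Finset.mem_image.mp h
            have : a ∈ X.erase y := by rw [← h]; simp
            grind
        simp [this, h2]
      · exact key (X.erase b) (hA _ (by grind) (by grind) (by grind)) (by simp)
          (Finset.erase_subset _ _)
  · have h1 := Finset.card_insert_le ({x, a, b} : Finset (Fin n)) (insert {y, a, b} (T \ R))
    have h2 := Finset.card_insert_le ({y, a, b} : Finset (Fin n)) (T \ R)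
    have h3 := Finset.card_sdiff_of_subset hRT
    have h4 := Finset.card_le_card hRT
    omega

theorem triple_lower {n : ℕ} (hn : 6 ≤ n) {T : Finset (Finset (Fin n))}
    (hT : IsTuranSystem n 4 3 T) (W : Finset (Fin n)) (hW : W.card = 3)
    (hbad : ∀ B ∈ T, (W \ B).card ≠ 1) :
    (T.filter (fun B => Disjoint B W)).card + 1 + 2 * (n - 3).choose 2 ≤ T.card := by
  classical
  have hWT : W ∈ T := by
    have : ∃ a, a ∉ W := by
      by_contra! hcon
      have h1 : Finset.univ ⊆ W := fun a _ => hcon a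
      have h2 := Finset.card_le_card h1
      simp at h2; omega
    obtain ⟨a, ha⟩ := this
    obtain ⟨u, hu, h⟩ := turan_erase hT (insert a W) (by rw [Finset.card_insert_of_notMem ha, hW])
    by_cases hua : u = a
    · subst hua; rwa [Finset.erase_insert ha] at h
    · exfalso
      apply hbad _ h
      rw [Finset.card_eq_one]
      exact ⟨u, by grind⟩
  have hpair : ∀ e : Finset (Fin n), e.card = 2 → Disjoint e W →
      2 ≤ (W.filter (fun v => insert v e ∈ T)).card := by
    intro e he hd
    have hd' := Finset.disjoint_left.mp hd
    have h1 : (W.filter (fun v => ¬ insert v e ∈ T)).card ≤ 1 := by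
      rw [Finset.card_le_one]
      intro v hv w hw
      rw [Finset.mem_filter] at hv hw
      by_contra hvw
      have hve : v ∉ e := fun h => hd' h hv.1
      have hwe : w ∉ e := fun h => hd' h hw.1
      obtain ⟨u, hu, h⟩ := turan_erase hT (insert v (insert w e)) (by
        rw [Finset.card_insert_of_notMem, Finset.card_insert_of_notMem hwe, he]
        grind)
      by_cases huv : u = v
      · subst huv
        rw [Finset.erase_insert (by grind)] at h
        exact hw.2 h
      by_cases huw : u = w
      · subst huw
        have : (insert v (insert u e)).erase u = insert v e := by grind
        rw [this] at h
        exact hv.2 h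
      apply hbad _ h
      have : W \ (insert v (insert w e)).erase u = W \ {v, w} := by
        ext z
        have := @hd' z
        have := @hd' u
        simp only [Finset.mem_sdiff, Finset.mem_erase, Finset.mem_insert, Finset.mem_singleton]
        grind
      rw [this, Finset.card_sdiff_of_subset (by grind), hW, Finset.card_pair hvw]
    have h2 := Finset.card_filter_add_card_filter_not (s := W) (fun v => insert v e ∈ T)
    omega
  set P := Finset.powersetCard 2 (Finset.univ \ W) with hP
  have hPc : P.card = (n - 3).choose 2 := by
    rw [hP, Finset.card_powersetCard, Finset.card_sdiff_of_subset (Finset.subset_univ _), hW]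
    simp
  have hPm : ∀ e ∈ P, e.card = 2 ∧ Disjoint e W := by
    intro e he
    rw [hP, Finset.mem_powersetCard] at he
    exact ⟨he.2, Finset.disjoint_left.mpr fun z hz => (Finset.mem_sdiff.mp (he.1 hz)).2⟩
  set U := P.sigma (fun e => W.filter (fun v => insert v e ∈ T)) with hU
  have hUc : 2 * (n - 3).choose 2 ≤ U.card := by
    rw [hU, Finset.card_sigma, ← hPc, mul_comm, ← smul_eq_mul]
    exact Finset.card_nsmul_le_sum _ _ _ fun e he => hpair e (hPm e he).1 (hPm e he).2
  set I := U.image (fun p => insert p.2 p.1) with hI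
  have hIc : I.card = U.card := by
    rw [hI]
    apply Finset.card_image_of_injOn
    rintro ⟨e, v⟩ h1 ⟨f, w⟩ h2 h
    simp only [hU, Finset.mem_coe, Finset.mem_sigma, Finset.mem_filter] at h1 h2
    have de := Finset.disjoint_left.mp (hPm e h1.1).2
    have df := Finset.disjoint_left.mp (hPm f h2.1).2
    have h' : insert v e = insert w f := h
    have hvw : v = w := by
      have : v ∈ insert w f := by rw [← h']; simp
      rcases Finset.mem_insert.mp this with h | h
      · exact h
      · exact absurd h1.2.1 (df h)
    subst hvw
    have hef : e = f := by
      rw [← Finset.erase_insert (fun h => de h h1.2.1), h',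
        Finset.erase_insert (fun h => df h h2.2.1)]
    subst hef
    rfl
  have hImem : ∀ B ∈ I, B ∈ T ∧ (B ∩ W).card = 1 := by
    intro B hB
    obtain ⟨⟨e, v⟩, h1, rfl⟩ := Finset.mem_image.mp hB
    simp only [hU, Finset.mem_sigma, Finset.mem_filter] at h1
    refine ⟨h1.2.2, ?_⟩
    have := Finset.disjoint_iff_inter_eq_empty.mp (hPm e h1.1).2
    simp only
    rw [Finset.insert_inter_of_mem h1.2.1, this]
    simp
  have hd1 : Disjoint (T.filter (fun B => Disjoint B W)) I := by
    rw [Finset.disjoint_left]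
    intro B hB hBI
    have h1 := (hImem B hBI).2
    rw [Finset.disjoint_iff_inter_eq_empty.mp (Finset.mem_filter.mp hB).2] at h1
    simp at h1
  have hWn : W ∉ (T.filter (fun B => Disjoint B W)) ∪ I := by
    intro h
    rcases Finset.mem_union.mp h with h | h
    · have := (Finset.mem_filter.mp h).2
      rw [disjoint_self] at this
      rw [this] at hW
      simp at hW
    · have := (hImem W h).2
      rw [Finset.inter_self] at this
      omega
  have hsub : insert W ((T.filter (fun B => Disjoint B W)) ∪ I) ⊆ T := by
    intro B hB
    rcases Finset.mem_insert.mp hB with rfl | hB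
    · exact hWT
    rcases Finset.mem_union.mp hB with h | h
    · exact (Finset.mem_filter.mp h).1
    · exact (hImem B h).1
  have := Finset.card_le_card hsub
  rw [Finset.card_insert_of_notMem hWn, Finset.card_union_of_disjoint hd1] at this
  omega

theorem choose_arith (s r : ℕ) (h : s = r ∨ s = r + 1) (h5 : 5 ≤ s + r) :
    3 * (s.choose 2 + r.choose 2) + 3 * r < 2 * (s + r).choose 2 := by
  have key : ∀ k : ℕ, 2 * k.choose 2 + k = k * k := by
    intro k
    induction k with
    | zero => simp
    | succ k ih =>
      have : (k + 1).choose 2 = k + k.choose 2 := by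
        rw [Nat.choose_succ_succ' k 1]; simp
      rw [this]; nlinarith
  have h1 := key s
  have h2 := key r
  have h3 := key (s + r)
  rcases h with rfl | rfl
  · have : 3 ≤ s := by omega
    nlinarith
  · have : 2 ≤ r := by omega
    nlinarith

theorem triple_bad {n : ℕ} (hn : 8 ≤ n) {T : Finset (Finset (Fin n))}
    (hT : IsTuranSystem n 4 3 T) (W : Finset (Fin n)) (hW : W.card = 3)
    (hbad : ∀ B ∈ T, (W \ B).card ≠ 1) :
    ∃ T', IsTuranSystem n 4 3 T' ∧ T'.card < T.card := by
  classical
  have hlow := triple_lower (by omega) hT W hW hbad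
  have hAc : (Finset.univ \ W).card = n - 3 := by
    rw [Finset.card_sdiff_of_subset (Finset.subset_univ _), hW]; simp
  obtain ⟨R, hRA, hRc⟩ := Finset.exists_subset_card_eq (s := Finset.univ \ W) (n := (n - 3) / 2)
    (by omega)
  set S := (Finset.univ \ W) \ R with hS
  have hSc : S.card = (n - 3) - (n - 3) / 2 := by
    rw [hS, Finset.card_sdiff_of_subset hRA, hAc, hRc]
  have hRW : ∀ z ∈ R, z ∉ W := fun z hz => (Finset.mem_sdiff.mp (hRA hz)).2
  have hSm : ∀ z, z ∈ S ↔ z ∉ W ∧ z ∉ R := by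
    intro z; simp [hS]
  set I := (W ×ˢ (Finset.powersetCard 2 S ∪ Finset.powersetCard 2 R)).image
    (fun p => insert p.1 p.2) with hI
  set J := (W ×ˢ R).image (fun p => insert p.2 (W.erase p.1)) with hJ
  refine ⟨insert W ((T.filter (fun B => Disjoint B W)) ∪ (I ∪ J)), ⟨?_, ?_⟩, ?_⟩
  · intro B hB
    simp only [Finset.mem_insert, Finset.mem_union] at hB
    rcases hB with rfl | hB | hB | hB
    · exact hW
    · exact hT.1 B (Finset.mem_filter.mp hB).1
    · obtain ⟨⟨v, e⟩, h1, rfl⟩ := Finset.mem_image.mp hB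
      simp only [Finset.mem_product, Finset.mem_union, Finset.mem_powersetCard] at h1
      have : v ∉ e := by
        intro hv
        rcases h1.2 with h | h
        · exact ((hSm v).mp (h.1 hv)).1 h1.1
        · exact hRW v (h.1 hv) h1.1
      simp only
      rw [Finset.card_insert_of_notMem this]
      rcases h1.2 with h | h <;> omega
    · obtain ⟨⟨v, a⟩, h1, rfl⟩ := Finset.mem_image.mp hB
      simp only [Finset.mem_product] at h1
      have := hRW a h1.2
      simp only
      rw [Finset.card_insert_of_notMem (fun h => this (Finset.mem_of_mem_erase h)),
        Finset.card_erase_of_mem h1.1, hW]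
  · intro X hX
    have hsplit := Finset.card_inter_add_card_sdiff X W
    have hle : (X ∩ W).card ≤ 3 := hW ▸ Finset.card_le_card Finset.inter_subset_right
    have hXS : X \ W = (X ∩ S) ∪ (X ∩ R) := by
      ext z
      have := hRW z
      simp only [Finset.mem_sdiff, Finset.mem_union, Finset.mem_inter, hSm]
      tauto
    have hcl := Finset.card_union_le (X ∩ S) (X ∩ R)
    rw [← hXS] at hcl
    have hIex : ∀ v ∈ X ∩ W, (2 ≤ (X ∩ S).card ∨ 2 ≤ (X ∩ R).card) → ∃ B ∈ I, B ⊆ X := by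
      intro v hv h
      have : ∃ e ∈ Finset.powersetCard 2 S ∪ Finset.powersetCard 2 R, e ⊆ X := by
        rcases h with h | h
        · obtain ⟨e, he, hc⟩ := Finset.exists_subset_card_eq h
          refine ⟨e, Finset.mem_union_left _ (Finset.mem_powersetCard.mpr
            ⟨he.trans Finset.inter_subset_right, hc⟩), he.trans Finset.inter_subset_left⟩
        · obtain ⟨e, he, hc⟩ := Finset.exists_subset_card_eq h
          refine ⟨e, Finset.mem_union_right _ (Finset.mem_powersetCard.mpr
            ⟨he.trans Finset.inter_subset_right, hc⟩), he.trans Finset.inter_subset_left⟩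
      obtain ⟨e, he, heX⟩ := this
      have hv' := Finset.mem_inter.mp hv
      exact ⟨insert v e, Finset.mem_image.mpr ⟨(v, e), Finset.mem_product.mpr ⟨hv'.2, he⟩, rfl⟩,
        Finset.insert_subset hv'.1 heX⟩
    have hIex' : (∃ B ∈ I, B ⊆ X) →
        ∃ B ∈ insert W ((T.filter (fun B => Disjoint B W)) ∪ (I ∪ J)), B ⊆ X := by
      rintro ⟨B, hB, hBX⟩
      exact ⟨B, by simp [hB], hBX⟩
    by_cases h3 : (X ∩ W).card = 3
    · refine ⟨W, by simp, ?_⟩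
      have : X ∩ W = W := Finset.eq_of_subset_of_card_le Finset.inter_subset_right (by omega)
      rw [← this]; exact Finset.inter_subset_left
    by_cases h0 : (X ∩ W).card = 0
    · obtain ⟨B, hB, hBX⟩ := hT.2 X hX
      refine ⟨B, ?_, hBX⟩
      have hd : Disjoint X W := Finset.disjoint_iff_inter_eq_empty.mpr (Finset.card_eq_zero.mp h0)
      have : Disjoint B W := hd.mono_left hBX
      simp [hB, this]
    obtain ⟨v, hv⟩ : (X ∩ W).Nonempty := Finset.card_pos.mp (by omega)
    by_cases h1 : (X ∩ W).card = 1
    · exact hIex' (hIex v hv (by omega))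
    have h2 : (X ∩ W).card = 2 := by omega
    by_cases hRX : (X ∩ R).card = 0
    · exact hIex' (hIex v hv (by omega))
    obtain ⟨a, ha⟩ : (X ∩ R).Nonempty := Finset.card_pos.mp (by omega)
    have ha' := Finset.mem_inter.mp ha
    have hWX : (W \ X).card = 1 := by
      have := Finset.card_inter_add_card_sdiff W X
      rw [Finset.inter_comm] at this
      omega
    obtain ⟨w, hw⟩ := Finset.card_eq_one.mp hWX
    have hw' : w ∈ W \ X := by rw [hw]; simp
    refine ⟨insert a (W.erase w), ?_, ?_⟩
    · have : insert a (W.erase w) ∈ J := Finset.mem_image.mpr ⟨(w, a),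
        Finset.mem_product.mpr ⟨(Finset.mem_sdiff.mp hw').1, ha'.2⟩, rfl⟩
      simp [this]
    · apply Finset.insert_subset ha'.1
      intro z hz
      by_contra hzX
      have : z ∈ W \ X := Finset.mem_sdiff.mpr ⟨Finset.mem_of_mem_erase hz, hzX⟩
      rw [hw, Finset.mem_singleton] at this
      subst this
      simp at hz
  · have c1 := Finset.card_insert_le W ((T.filter (fun B => Disjoint B W)) ∪ (I ∪ J))
    have c2 := Finset.card_union_le (T.filter (fun B => Disjoint B W)) (I ∪ J)
    have c3 := Finset.card_union_le I J
    have c4 : I.card ≤ 3 * (S.card.choose 2 + R.card.choose 2) := by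
      refine Finset.card_image_le.trans ?_
      rw [Finset.card_product, hW]
      have := Finset.card_union_le (Finset.powersetCard 2 S) (Finset.powersetCard 2 R)
      rw [Finset.card_powersetCard, Finset.card_powersetCard] at this
      omega
    have c5 : J.card ≤ 3 * R.card := by
      refine Finset.card_image_le.trans ?_
      rw [Finset.card_product, hW]
    have c6 := choose_arith S.card R.card (by omega) (by omega)
    have c7 : S.card + R.card = n - 3 := by omega
    rw [c7] at c6
    omega

theorem turan_six : ∃ T, IsTuranSystem 6 4 3 T ∧ T.card ≤ 6 := by
  refine ⟨{{0,1,2},{0,1,3},{2,3,4},{2,3,5},{4,5,0},{4,5,1}}, ⟨by decide +kernel, ?_⟩,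
    by decide +kernel⟩
  decide +kernel

theorem turan_seven : ∃ T, IsTuranSystem 7 4 3 T ∧ T.card ≤ 12 := by
  refine ⟨{{0,1,2},{0,1,3},{0,1,4},{0,2,3},{0,2,4},{1,2,3},{1,2,4},{3,4,5},{3,4,6},
    {5,6,0},{5,6,1},{5,6,2}}, ⟨by decide +kernel, ?_⟩, by decide +kernel⟩
  decide +kernel

theorem min_se {n : ℕ} (hn : 6 ≤ n) {T : Finset (Finset (Fin n))}
    (hT : IsTuranSystem n 4 3 T)
    (hmin : ∀ T', IsTuranSystem n 4 3 T' → T.card ≤ T'.card) : IsSESystem n 3 T := by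
  classical
  refine ⟨hT.1, fun X h1 h4 => ?_⟩
  by_contra! hbad
  have hcases : X.card = 1 ∨ X.card = 2 ∨ X.card = 3 ∨ X.card = 4 := by omega
  rcases hcases with h | h | h | h
  · have hc : 4 ≤ (Finset.univ \ X).card := by
      rw [Finset.card_sdiff_of_subset (Finset.subset_univ _), h]; simp; omega
    obtain ⟨Y, hY, hYc⟩ := Finset.exists_subset_card_eq hc
    obtain ⟨B, hB, hBY⟩ := hT.2 Y hYc
    apply hbad B hB
    rw [Finset.sdiff_eq_self_of_disjoint, h]
    rw [Finset.disjoint_right]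
    intro z hz
    exact (Finset.mem_sdiff.mp (hY (hBY hz))).2
  · obtain ⟨x, y, hxy, rfl⟩ := Finset.card_eq_two.mp h
    obtain ⟨T', h1, h2⟩ := pair_bad hn hT x y hxy (by
      intro B hB
      have := hbad B hB
      by_contra hcon
      apply this
      rw [Finset.card_eq_one]
      by_cases hx : x ∈ B
      · exact ⟨y, by grind⟩
      · exact ⟨x, by grind⟩)
    have := hmin T' h1
    omega
  · by_cases h8 : 8 ≤ n
    · obtain ⟨T', h1, h2⟩ := triple_bad h8 hT X h hbad
      have := hmin T' h1
      omega
    have hlow := triple_lower hn hT X h hbad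
    have : n = 6 ∨ n = 7 := by omega
    rcases this with rfl | rfl
    · obtain ⟨T', h1, h2⟩ := turan_six
      have := hmin T' h1
      have : Nat.choose (6 - 3) 2 = 3 := by decide
      omega
    · obtain ⟨T', h1, h2⟩ := turan_seven
      have := hmin T' h1
      have : Nat.choose (7 - 3) 2 = 6 := by decide
      omega
  · obtain ⟨B, hB, hBX⟩ := hT.2 X h
    apply hbad B hB
    rw [Finset.card_sdiff_of_subset hBX, h, hT.1 B hB]

theorem stmt19 (n : ℕ) (hn : 6 ≤ n) :
    SENumber n 3 = turanNumber n 4 3 := by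
  have hne : {m : ℕ | ∃ T : Finset (Finset (Fin n)), IsTuranSystem n 4 3 T ∧ T.card = m}.Nonempty := by
    refine ⟨_, Finset.powersetCard 3 Finset.univ, ⟨?_, ?_⟩, rfl⟩
    · intro B hB
      exact (Finset.mem_powersetCard.mp hB).2
    · intro X hX
      obtain ⟨B, hB, hc⟩ := Finset.exists_subset_card_eq (s := X) (n := 3) (by omega)
      exact ⟨B, Finset.mem_powersetCard.mpr ⟨Finset.subset_univ _, hc⟩, hB⟩
  obtain ⟨T, hT, hTc⟩ := Nat.sInf_mem hne
  have hTc' : T.card = turanNumber n 4 3 := hTc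
  have hse : IsSESystem n 3 T := min_se hn hT (by
    intro T' hT'
    rw [hTc]
    exact Nat.sInf_le ⟨T', hT', rfl⟩)
  apply le_antisymm
  · rw [← hTc']
    exact Nat.sInf_le ⟨T, hse, rfl⟩
  · obtain ⟨S, hS, hSc⟩ := Nat.sInf_mem
      (s := {m : ℕ | ∃ S : Finset (Finset (Fin n)), IsSESystem n 3 S ∧ S.card = m})
      ⟨_, T, hse, rfl⟩
    have hSc' : S.card = SENumber n 3 := hSc
    rw [← hSc']
    exact Nat.sInf_le ⟨S, se_turan hS, rfl⟩
end
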